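/- There exists a universal constant C > 0 such that for every n, every isotropic log-concave random vector X in ℝⁿ, every integer 1 ≤ m ≤ n, and every t ≥ 1, one has P(max_{|I|=m} |P_I X| ≥ C·t·√m·log(en/m)) ≤ exp(−σ_X^{−1}(t·√m·log(en/m))), where the maximum is over all subsets I ⊆ {1,…,n} of cardinality m and P_I denotes the coordinate projection from ℝⁿ onto ℝ^I. -/

import Mathlib

open MeasureTheory ProbabilityTheory Real
open scoped Pointwise ENNReal RealInnerProductSpace

noncomputable section

variable {Ω : Type*} [MeasurableSpace Ω]

/-- A random vector `X` in `ℝⁿ` is log-concave: for all nonempty compact sets `K, L` and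
`a ∈ [0,1]`, `P(X ∈ aK + (1-a)L) ≥ P(X ∈ K)^a * P(X ∈ L)^(1-a)`. -/
def IsLogConcave {n : ℕ} (μ : Measure Ω) (X : Ω → EuclideanSpace ℝ (Fin n)) : Prop :=
  ∀ K L : Set (EuclideanSpace ℝ (Fin n)), K.Nonempty → L.Nonempty →
    IsCompact K → IsCompact L → ∀ a : ℝ, 0 ≤ a → a ≤ 1 →
      (μ (X ⁻¹' K)).toReal ^ a * (μ (X ⁻¹' L)).toReal ^ (1 - a) ≤
        (μ (X ⁻¹' (a • K + (1 - a) • L))).toReal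

/-- `X` is isotropic: centered with identity covariance matrix. -/
def IsIsotropic {n : ℕ} (μ : Measure Ω) (X : Ω → EuclideanSpace ℝ (Fin n)) : Prop :=
  (∀ i, ∫ ω, X ω i ∂μ = 0) ∧
  ∀ i j, ∫ ω, X ω i * X ω j ∂μ = if i = j then (1 : ℝ) else 0

/-- `σ_X(p) = sup_{|t| = 1} (E|⟨t,X⟩|^p)^(1/p)`. -/
def sigmaX {n : ℕ} (μ : Measure Ω) (X : Ω → EuclideanSpace ℝ (Fin n)) (p : ℝ) : ℝ :=
  ⨆ t : {t : EuclideanSpace ℝ (Fin n) // ‖t‖ = 1},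
    (∫ ω, |⟪t.1, X ω⟫| ^ p ∂μ) ^ (1 / p)

/-- Generalized inverse of `σ_X`. -/
def sigmaXInv {n : ℕ} (μ : Measure Ω) (X : Ω → EuclideanSpace ℝ (Fin n)) (s : ℝ) : ℝ :=
  sSup {p : ℝ | 1 ≤ p ∧ sigmaX μ X p ≤ s}

/-- A measure is log-concave on sets: `ν A ^ a * ν B ^ (1 - a) ≤ ν D` whenever `D` contains all
convex combinations `a • x + (1 - a) • y` with `x ∈ A`, `y ∈ B`. -/
def LogConcaveMeasure {V : Type*} [AddCommGroup V] [Module ℝ V] [MeasurableSpace V]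
    (ν : Measure V) : Prop :=
  ∀ A B D : Set V, MeasurableSet A → MeasurableSet B → MeasurableSet D → ∀ a : ℝ, 0 < a → a < 1 →
    (∀ x ∈ A, ∀ y ∈ B, a • x + (1 - a) • y ∈ D) → ν A ^ a * ν B ^ (1 - a) ≤ ν D

namespace LogConcaveMeasure

variable {V W : Type*} [AddCommGroup V] [Module ℝ V] [MeasurableSpace V]
  [AddCommGroup W] [Module ℝ W] [MeasurableSpace W]

lemma map {ν : Measure V} (h : LogConcaveMeasure ν) (f : V →ₗ[ℝ] W) (hf : Measurable f) :
    LogConcaveMeasure (ν.map f) := by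
  intro A B D hA hB hD a ha ha1 hABD
  rw [Measure.map_apply hf hA, Measure.map_apply hf hB, Measure.map_apply hf hD]
  refine h _ _ _ (hf hA) (hf hB) (hf hD) a ha ha1 fun x hx y hy => ?_
  simpa using hABD _ hx _ hy

lemma restrict {ν : Measure V} (h : LogConcaveMeasure ν) {K : Set V} (hK : Convex ℝ K)
    (hKm : MeasurableSet K) : LogConcaveMeasure (ν.restrict K) := by
  intro A B D hA hB hD a ha ha1 hABD
  rw [Measure.restrict_apply hA, Measure.restrict_apply hB, Measure.restrict_apply hD]
  refine h _ _ _ (hA.inter hKm) (hB.inter hKm) (hD.inter hKm) a ha ha1 fun x hx y hy => ?_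
  exact ⟨hABD _ hx.1 _ hy.1, hK hx.2 hy.2 ha.le (by linarith) (by ring)⟩

lemma smul {ν : Measure V} (h : LogConcaveMeasure ν) {c : ℝ≥0∞} (hc : c ≠ 0) (hc' : c ≠ ∞) :
    LogConcaveMeasure (c • ν) := by
  intro A B D hA hB hD a ha ha1 hABD
  simp only [Measure.smul_apply, smul_eq_mul]
  rw [ENNReal.mul_rpow_of_nonneg _ _ ha.le, ENNReal.mul_rpow_of_nonneg _ _ (by linarith)]
  have h1 : c ^ a * c ^ (1 - a) = c := by
    rw [← ENNReal.rpow_add _ _ hc hc']; simp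
  calc c ^ a * ν A ^ a * (c ^ (1 - a) * ν B ^ (1 - a))
      = (c ^ a * c ^ (1 - a)) * (ν A ^ a * ν B ^ (1 - a)) := by ring
    _ ≤ c * ν D := by rw [h1]; gcongr; exact h A B D hA hB hD a ha ha1 hABD

lemma cond {ν : Measure V} [IsFiniteMeasure ν] (h : LogConcaveMeasure ν) {K : Set V}
    (hK : Convex ℝ K) (hKm : MeasurableSet K) (h0 : ν K ≠ 0) :
    LogConcaveMeasure (ProbabilityTheory.cond ν K) :=
  (h.restrict hK hKm).smul (by simp) (by simpa using h0)

end LogConcaveMeasure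

lemma IsLogConcave.logConcaveMeasure_map {Ω : Type*} [MeasurableSpace Ω] {μ : Measure Ω}
    [IsProbabilityMeasure μ] {n : ℕ}
    {X : Ω → EuclideanSpace ℝ (Fin n)} (h : IsLogConcave μ X) (hX : Measurable X) :
    LogConcaveMeasure (μ.map X) := by
  have : IsProbabilityMeasure (μ.map X) := Measure.isProbabilityMeasure_map hX.aemeasurable
  intro A B D hA hB hD a ha ha1 hABD
  have key : ∀ K L : Set (EuclideanSpace ℝ (Fin n)), K ⊆ A → L ⊆ B → K.Nonempty → L.Nonempty →
      IsCompact K → IsCompact L → μ.map X K ^ a * μ.map X L ^ (1 - a) ≤ μ.map X D := by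
    intro K L hKA hLB hK hL hKc hLc
    have h1 := h K L hK hL hKc hLc a ha.le ha1.le
    have hsub : a • K + (1 - a) • L ⊆ D := by
      rintro _ ⟨_, ⟨x, hx, rfl⟩, _, ⟨y, hy, rfl⟩, rfl⟩
      exact hABD x (hKA hx) y (hLB hy)
    have h2 : (μ (X ⁻¹' K)).toReal ^ a * (μ (X ⁻¹' L)).toReal ^ (1 - a) ≤
        (μ (X ⁻¹' D)).toReal :=
      h1.trans (ENNReal.toReal_mono (measure_ne_top _ _)
        (measure_mono (Set.preimage_mono hsub)))
    rw [Measure.map_apply hX hKc.measurableSet, Measure.map_apply hX hLc.measurableSet,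
      Measure.map_apply hX hD]
    rw [ENNReal.toReal_rpow, ENNReal.toReal_rpow, ← ENNReal.toReal_mul,
      ENNReal.toReal_le_toReal _ (measure_ne_top _ _)] at h2
    · exact h2
    · exact ENNReal.mul_ne_top (ENNReal.rpow_ne_top_of_nonneg ha.le (measure_ne_top _ _))
        (ENNReal.rpow_ne_top_of_nonneg (by linarith) (measure_ne_top _ _))
  have hb : 0 < 1 - a := by linarith
  refine ENNReal.mul_le_of_forall_lt fun r hr s hs => ?_
  have hr' : r ^ (1 / a) < μ.map X A := by
    have := ENNReal.rpow_lt_rpow hr (z := 1 / a) (by positivity)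
    rwa [← ENNReal.rpow_mul, mul_one_div_cancel ha.ne', ENNReal.rpow_one] at this
  have hs' : s ^ (1 / (1 - a)) < μ.map X B := by
    have := ENNReal.rpow_lt_rpow hs (z := 1 / (1 - a)) (by positivity)
    rwa [← ENNReal.rpow_mul, mul_one_div_cancel hb.ne', ENNReal.rpow_one] at this
  obtain ⟨K, hKA, hKc, hK⟩ := hA.exists_lt_isCompact hr'
  obtain ⟨L, hLB, hLc, hL⟩ := hB.exists_lt_isCompact hs'
  have hKn : K.Nonempty := by
    rw [Set.nonempty_iff_ne_empty]; rintro rfl; simp at hK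
  have hLn : L.Nonempty := by
    rw [Set.nonempty_iff_ne_empty]; rintro rfl; simp at hL
  refine le_trans ?_ (key K L hKA hLB hKn hLn hKc hLc)
  have e1 : r = (r ^ (1 / a)) ^ a := by
    rw [← ENNReal.rpow_mul, one_div_mul_cancel ha.ne', ENNReal.rpow_one]
  have e2 : s = (s ^ (1 / (1 - a))) ^ (1 - a) := by
    rw [← ENNReal.rpow_mul, one_div_mul_cancel hb.ne', ENNReal.rpow_one]
  rw [e1, e2]
  gcongr

lemma LogConcaveMeasure.real_le {V : Type*} [AddCommGroup V] [Module ℝ V] [MeasurableSpace V]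
    {ν : Measure V} [IsFiniteMeasure ν] (h : LogConcaveMeasure ν) {A B D : Set V}
    (hA : MeasurableSet A) (hB : MeasurableSet B) (hD : MeasurableSet D) {a : ℝ} (ha : 0 < a)
    (ha1 : a < 1) (hABD : ∀ x ∈ A, ∀ y ∈ B, a • x + (1 - a) • y ∈ D) :
    ν.real A ^ a * ν.real B ^ (1 - a) ≤ ν.real D := by
  have := ENNReal.toReal_mono (measure_ne_top _ _) (h A B D hA hB hD a ha ha1 hABD)
  rwa [ENNReal.toReal_mul, ← ENNReal.toReal_rpow, ← ENNReal.toReal_rpow] at this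

lemma measure_norm_ge_le {V : Type*} [NormedAddCommGroup V] [MeasurableSpace V]
    [OpensMeasurableSpace V] {ν : Measure V} {p M s : ℝ} (hp : 0 < p) (hM : 0 < M) (hs : 0 < s)
    (hm : ∫⁻ x, ‖x‖ₑ ^ p ∂ν ≤ ENNReal.ofReal (M ^ p)) :
    ν {x | s ≤ ‖x‖} ≤ ENNReal.ofReal ((M / s) ^ p) := by
  have h1 : {x : V | s ≤ ‖x‖} ⊆ {x | ENNReal.ofReal (s ^ p) ≤ ‖x‖ₑ ^ p} := by
    intro x hx
    simp only [Set.mem_ofPred_eq] at hx ⊢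
    rw [← ofReal_norm, ENNReal.ofReal_rpow_of_nonneg (norm_nonneg _) hp.le]
    exact ENNReal.ofReal_le_ofReal (Real.rpow_le_rpow hs.le hx hp.le)
  have h2 := (mul_meas_ge_le_lintegral (μ := ν) (f := fun x : V => ‖x‖ₑ ^ p) (by fun_prop)
    (ENNReal.ofReal (s ^ p))).trans hm
  have hsp : 0 < s ^ p := by positivity
  refine (measure_mono h1).trans ?_
  rw [Real.div_rpow hM.le hs.le, ENNReal.ofReal_div_of_pos hsp,
    ENNReal.le_div_iff_mul_le (by simp [hsp]) (by simp), mul_comm]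
  exact h2

/-- Borell's lemma: tails of norms of log-concave vectors decay exponentially. -/
lemma LogConcaveMeasure.norm_tail_le {V : Type*} [NormedAddCommGroup V] [NormedSpace ℝ V]
    [MeasurableSpace V] [OpensMeasurableSpace V] {ν : Measure V} [IsProbabilityMeasure ν]
    (h : LogConcaveMeasure ν) {p M z : ℝ} (hp : 1 ≤ p) (hM : 0 < M)
    (hm : ∫⁻ x, ‖x‖ₑ ^ p ∂ν ≤ ENNReal.ofReal (M ^ p)) :
    ν {x | z * (exp 3 * M) ≤ ‖x‖} ≤ ENNReal.ofReal (exp (-(p * (z - 1)))) := by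
  rcases le_or_gt z 1 with hz | hz
  · refine prob_le_one.trans ?_
    rw [← ENNReal.ofReal_one]
    apply ENNReal.ofReal_le_ofReal
    apply Real.one_le_exp
    nlinarith
  have hs : 0 < exp 3 * M := by positivity
  set s := exp 3 * M with hsdef
  have hθ := measure_norm_ge_le (by linarith) hM hs hm
  have hθ' : ν.real {x | s ≤ ‖x‖} ≤ exp (-(3 * p)) := by
    have : M / s = exp (-3) := by
      rw [hsdef, Real.exp_neg]; field_simp
    rw [this, ← Real.exp_mul] at hθ
    refine (ENNReal.toReal_le_of_le_ofReal (exp_pos _).le hθ).trans (le_of_eq ?_)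
    ring_nf
  have hAm : MeasurableSet {x : V | z * s ≤ ‖x‖} := measurableSet_le (by fun_prop) (by fun_prop)
  have hDm : MeasurableSet {x : V | s ≤ ‖x‖} := measurableSet_le (by fun_prop) (by fun_prop)
  have hB : ν.real {x | s ≤ ‖x‖}ᶜ = 1 - ν.real {x | s ≤ ‖x‖} := by
    rw [measureReal_compl hDm]; simp
  have hexp3 : exp (-(3 * p)) ≤ 1 / 2 := by
    have h3 := Real.add_one_le_exp (3 * p)
    rw [Real.exp_neg, one_div]
    apply inv_anti₀ <;> linarith
  set a : ℝ := 2 / (z + 1) with ha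
  have hz1 : 0 < z + 1 := by linarith
  have ha0 : 0 < a := by positivity
  have ha1 : a < 1 := by rw [ha, div_lt_one hz1]; linarith
  have haz : a * (z + 1) = 2 := by rw [ha]; field_simp
  have key := h.real_le hAm hDm.compl hDm ha0 ha1 (by
    intro x hx y hy
    simp only [Set.mem_ofPred_eq, Set.mem_compl_iff, not_le] at hx hy ⊢
    have h1 : ‖a • x‖ - ‖(1 - a) • y‖ ≤ ‖a • x + (1 - a) • y‖ := by
      have := norm_sub_norm_le (a • x) (-((1 - a) • y))
      rwa [norm_neg, sub_neg_eq_add] at this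
    rw [norm_smul, norm_smul, Real.norm_of_nonneg ha0.le,
      Real.norm_of_nonneg (by linarith : 0 ≤ 1 - a)] at h1
    have h2 : a * (z * s) ≤ a * ‖x‖ := by gcongr
    have h3 : (1 - a) * ‖y‖ ≤ (1 - a) * s := by gcongr
    have h4 : a * (z * s) - (1 - a) * s = s := by linear_combination s * haz
    linarith)
  set A := ν.real {x | z * s ≤ ‖x‖}
  have hhalf : (1 / 2 : ℝ) ≤ ν.real {x | s ≤ ‖x‖}ᶜ ^ (1 - a) := by
    calc (1 / 2 : ℝ) = (1 / 2 : ℝ) ^ (1 : ℝ) := by simp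
      _ ≤ (1 / 2 : ℝ) ^ (1 - a) :=
        Real.rpow_le_rpow_of_exponent_ge (by norm_num) (by norm_num) (by linarith)
      _ ≤ _ := Real.rpow_le_rpow (by norm_num) (by rw [hB]; linarith) (by linarith)
  have hA0 : 0 ≤ A := measureReal_nonneg
  have h5 : A ^ a ≤ exp (-(2 * p)) := by
    have h6 : A ^ a * (1 / 2) ≤ exp (-(3 * p)) :=
      (mul_le_mul_of_nonneg_left hhalf (by positivity)).trans (key.trans hθ')
    have h7 : exp (-(3 * p)) = exp (-(2 * p)) * exp (-p) := by
      rw [← Real.exp_add]; ring_nf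
    have h8 : exp (-p) ≤ 1 / 2 := by
      have h3 := Real.add_one_le_exp p
      rw [Real.exp_neg, one_div]
      apply inv_anti₀ <;> linarith
    have h9 : 0 < exp (-(2 * p)) := exp_pos _
    nlinarith
  have h10 : A ≤ exp (-(p * (z - 1))) := by
    have h11 := Real.rpow_le_rpow (by positivity) h5 (by positivity : 0 ≤ 1 / a)
    rw [← Real.rpow_mul hA0, mul_one_div_cancel ha0.ne', Real.rpow_one, ← Real.exp_mul] at h11
    refine h11.trans (Real.exp_le_exp.mpr ?_)
    have : 1 / a = (z + 1) / 2 := by rw [ha]; field_simp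
    rw [this]; nlinarith
  rw [← ENNReal.ofReal_toReal (measure_ne_top ν {x | z * s ≤ ‖x‖})]
  exact ENNReal.ofReal_le_ofReal h10

lemma LogConcaveMeasure.lintegral_exp_norm_le {V : Type*} [NormedAddCommGroup V] [NormedSpace ℝ V]
    [MeasurableSpace V] [OpensMeasurableSpace V] {ν : Measure V} [IsProbabilityMeasure ν]
    (h : LogConcaveMeasure ν) {p M : ℝ} (hp : 1 ≤ p) (hM : 0 < M)
    (hm : ∫⁻ x, ‖x‖ₑ ^ p ∂ν ≤ ENNReal.ofReal (M ^ p)) :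
    ∫⁻ x, ENNReal.ofReal (exp (p / 2 * (‖x‖ / (exp 3 * M)))) ∂ν ≤
      ENNReal.ofReal (3 * exp (3 * p / 2)) := by
  set s := exp 3 * M with hsdef
  have hs : 0 < s := by positivity
  have hmeas : ∀ j : ℕ, MeasurableSet {x : V | (j : ℝ) * s ≤ ‖x‖} := fun j =>
    measurableSet_le (by fun_prop) (by fun_prop)
  have h1 : ∀ x : V, ENNReal.ofReal (exp (p / 2 * (‖x‖ / s))) ≤
      ∑' j : ℕ, {x : V | (j : ℝ) * s ≤ ‖x‖}.indicator
        (fun _ => ENNReal.ofReal (exp (p / 2 * (j + 1)))) x := by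
    intro x
    have h0 : 0 ≤ ‖x‖ / s := by positivity
    refine le_trans ?_ (ENNReal.le_tsum ⌊‖x‖ / s⌋₊)
    rw [Set.indicator_of_mem]
    · apply ENNReal.ofReal_le_ofReal
      apply Real.exp_le_exp.mpr
      gcongr
      exact (Nat.lt_floor_add_one _).le
    · change (⌊‖x‖ / s⌋₊ : ℝ) * s ≤ ‖x‖
      rw [← le_div_iff₀ hs]
      exact Nat.floor_le h0
  refine (lintegral_mono h1).trans ?_
  rw [lintegral_tsum (fun j => (measurable_const.indicator (hmeas j)).aemeasurable)]
  have h2 : ∀ j : ℕ, ∫⁻ x, {x : V | (j : ℝ) * s ≤ ‖x‖}.indicator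
        (fun _ => ENNReal.ofReal (exp (p / 2 * (j + 1)))) x ∂ν ≤
      ENNReal.ofReal (exp (3 * p / 2) * exp (-(1 / 2)) ^ j) := by
    intro j
    rw [lintegral_indicator_const (hmeas j)]
    refine (mul_le_mul_right (h.norm_tail_le hp hM hm) _).trans ?_
    rw [← ENNReal.ofReal_mul (exp_pos _).le]
    apply ENNReal.ofReal_le_ofReal
    rw [← Real.exp_nat_mul, ← Real.exp_add, ← Real.exp_add]
    apply Real.exp_le_exp.mpr
    have : (0 : ℝ) ≤ j := by positivity
    nlinarith
  refine (ENNReal.tsum_le_tsum h2).trans ?_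
  have hlt : exp (-(1 / 2)) ≤ 2 / 3 := by
    have h3 := Real.add_one_le_exp (1 / 2 : ℝ)
    rw [Real.exp_neg, show (2 / 3 : ℝ) = (3 / 2)⁻¹ by norm_num]
    apply inv_anti₀ <;> linarith
  have hsum := (hasSum_geometric_of_lt_one (exp_pos (-(1 / 2))).le (by linarith)).mul_left
    (exp (3 * p / 2))
  rw [← ENNReal.ofReal_tsum_of_nonneg (fun j => by positivity) hsum.summable, hsum.tsum_eq]
  apply ENNReal.ofReal_le_ofReal
  rw [mul_comm]
  gcongr
  rw [show (3 : ℝ) = (1 / 3)⁻¹ by norm_num]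
  apply inv_anti₀ <;> linarith

/-- Reverse Hölder inequality for norms of log-concave vectors. -/
lemma LogConcaveMeasure.exists_moment_le :
    ∃ K : ℝ, 1 ≤ K ∧ ∀ {V : Type} [NormedAddCommGroup V] [NormedSpace ℝ V]
      [MeasurableSpace V] [OpensMeasurableSpace V] {ν : Measure V} [IsProbabilityMeasure ν],
      LogConcaveMeasure ν → ∀ {p q M : ℝ}, 1 ≤ p → p ≤ q → 0 < M →
      ∫⁻ x, ‖x‖ₑ ^ p ∂ν ≤ ENNReal.ofReal (M ^ p) →
      ∫⁻ x, ‖x‖ₑ ^ q ∂ν ≤ ENNReal.ofReal ((K * (q / p) * M) ^ q) := by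
  refine ⟨2 * exp 3 * (3 * exp (3 / 2)), ?_, ?_⟩
  · have := Real.add_one_le_exp (3 : ℝ)
    have := Real.add_one_le_exp (3 / 2 : ℝ)
    nlinarith
  intro V _ _ _ _ ν _ h p q M hp hpq hM hm
  set s := exp 3 * M with hsdef
  have hs : 0 < s := by positivity
  have hq : 1 ≤ q := hp.trans hpq
  have hp0 : 0 < p := by linarith
  have hq0 : 0 < q := by linarith
  have h1 : ∀ x : V, ‖x‖ₑ ^ q ≤ ENNReal.ofReal ((2 * q / p * s) ^ q) *
      ENNReal.ofReal (exp (p / 2 * (‖x‖ / s))) := by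
    intro x
    rw [← ofReal_norm, ENNReal.ofReal_rpow_of_nonneg (norm_nonneg _) hq0.le,
      ← ENNReal.ofReal_mul (by positivity)]
    apply ENNReal.ofReal_le_ofReal
    set y := p / 2 * (‖x‖ / s) with hy
    have hx : ‖x‖ = (2 * q / p * s) * (y / q) := by rw [hy]; field_simp
    have hy0 : 0 ≤ y := by positivity
    have hyq : y / q ≤ exp (y / q) := by linarith [Real.add_one_le_exp (y / q)]
    calc ‖x‖ ^ q = (2 * q / p * s) ^ q * (y / q) ^ q := by
          rw [hx, Real.mul_rpow (by positivity) (by positivity)]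
      _ ≤ (2 * q / p * s) ^ q * exp (y / q) ^ q := by gcongr
      _ = _ := by rw [← Real.exp_mul]; congr 2; field_simp
  refine (lintegral_mono h1).trans ?_
  rw [lintegral_const_mul _ (by fun_prop)]
  refine (mul_le_mul_right (h.lintegral_exp_norm_le hp hM hm) _).trans ?_
  rw [← ENNReal.ofReal_mul (by positivity)]
  apply ENNReal.ofReal_le_ofReal
  have h2 : 3 * exp (3 * p / 2) ≤ (3 * exp (3 / 2)) ^ q := by
    rw [Real.mul_rpow (by norm_num) (exp_pos _).le, ← Real.exp_mul]
    have h3 : (3 : ℝ) ^ (1 : ℝ) ≤ 3 ^ q := Real.rpow_le_rpow_of_exponent_le (by norm_num) hq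
    rw [Real.rpow_one] at h3
    gcongr
    linarith
  calc (2 * q / p * s) ^ q * (3 * exp (3 * p / 2))
      ≤ (2 * q / p * s) ^ q * (3 * exp (3 / 2)) ^ q := by gcongr
    _ = _ := by
        rw [← Real.mul_rpow (by positivity) (by positivity)]
        congr 1; rw [hsdef]; ring

lemma lintegral_measure_closedBall {V : Type*} [NormedAddCommGroup V] [MeasurableSpace V]
    [BorelSpace V] [SecondCountableTopology V] (μ ρ : Measure V) [SFinite μ] [SFinite ρ]
    (T : Set V) (hT : MeasurableSet T) (r : ℝ) :
    ∫⁻ x in T, ρ (Metric.closedBall x r) ∂μ = ∫⁻ y, μ (T ∩ Metric.closedBall y r) ∂ρ := by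
  have hS : MeasurableSet {p : V × V | dist p.1 p.2 ≤ r} :=
    measurableSet_le (by fun_prop) (by fun_prop)
  have h1 := Measure.prod_apply (μ := μ.restrict T) (ν := ρ) hS
  rw [Measure.prod_apply_symm hS] at h1
  refine Eq.trans ?_ (h1.symm.trans ?_)
  · refine lintegral_congr fun x => ?_
    congr 1
    ext y
    simp [dist_comm]
  · refine lintegral_congr fun y => ?_
    rw [Measure.restrict_apply' hT, Set.inter_comm]
    congr 1

lemma measurable_measure_closedBall {V : Type*} [NormedAddCommGroup V] [MeasurableSpace V]
    [BorelSpace V] [SecondCountableTopology V] (ρ : Measure V) [SFinite ρ] (r : ℝ) :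
    Measurable fun x => ρ (Metric.closedBall x r) := by
  have hS : MeasurableSet {p : V × V | dist p.2 p.1 ≤ r} :=
    measurableSet_le (by fun_prop) (by fun_prop)
  exact measurable_measure_prodMk_left (ν := ρ) hS

lemma LogConcaveMeasure.closedBall_le {V : Type*} [NormedAddCommGroup V] [NormedSpace ℝ V]
    [MeasurableSpace V] [OpensMeasurableSpace V] {ν : Measure V} (h : LogConcaveMeasure ν)
    (s : ℝ) {a : ℝ} (ha : 0 < a) (ha1 : a < 1) (x y : V) :
    ν (Metric.closedBall x s) ^ a * ν (Metric.closedBall y s) ^ (1 - a) ≤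
      ν (Metric.closedBall (a • x + (1 - a) • y) s) := by
  refine h _ _ _ measurableSet_closedBall measurableSet_closedBall measurableSet_closedBall a ha ha1
    fun u hu v hv => ?_
  rw [mem_closedBall_iff_norm] at hu hv ⊢
  have e : a • u + (1 - a) • v - (a • x + (1 - a) • y) = a • (u - x) + (1 - a) • (v - y) := by
    module
  rw [e]
  refine (norm_add_le _ _).trans ?_
  rw [norm_smul, norm_smul, Real.norm_of_nonneg ha.le, Real.norm_of_nonneg (by linarith)]
  nlinarith

lemma map_two_smul_closedBall {V : Type*} [NormedAddCommGroup V] [NormedSpace ℝ V]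
    [MeasurableSpace V] [BorelSpace V] (ν : Measure V) (x : V) (s : ℝ) :
    (ν.map fun y : V => (2 : ℝ) • y) (Metric.closedBall x (2 * s)) =
      ν (Metric.closedBall ((1 / 2 : ℝ) • x) s) := by
  have hm2 : Measurable fun x : V => (2 : ℝ) • x := (continuous_const_smul 2).measurable
  rw [Measure.map_apply hm2 measurableSet_closedBall]
  have : (fun y : V => (2 : ℝ) • y) ⁻¹' Metric.closedBall x (2 * s) =
      Metric.closedBall ((1 / 2 : ℝ) • x) s := by
    ext y
    simp only [Metric.mem_closedBall, Set.mem_preimage]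
    have : dist ((2 : ℝ) • y) x = 2 * dist y ((1 / 2 : ℝ) • x) := by
      conv_lhs => rw [show x = (2 : ℝ) • (1 / 2 : ℝ) • x by simp [smul_smul]]
      rw [dist_smul₀]; simp
    rw [this]
    constructor <;> intro <;> linarith
  rw [this]

set_option maxHeartbeats 1000000 in
/-- If half of the mass of a log-concave measure on `ℝᵏ` lies in the ball of radius `s`, then
in some direction the mass at distance at least `b` is exponentially small, unless `b ≲ s`. -/
lemma LogConcaveMeasure.le_of_forall_direction {k : ℕ} (hk : 1 ≤ k)
    {ν : Measure (EuclideanSpace ℝ (Fin k))} [IsProbabilityMeasure ν] (hν : LogConcaveMeasure ν)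
    {s b δ : ℝ} (hs : 0 < s) (hδ : 0 < δ) (hδ1 : δ ≤ 1)
    (hball : 1 / 2 ≤ ν (Metric.closedBall 0 s))
    (hdir : ∀ t : EuclideanSpace ℝ (Fin k), ‖t‖ = 1 →
      ENNReal.ofReal (δ ^ k) ≤ ν {x | b ≤ |⟪t, x⟫|}) :
    b ≤ 768 / δ ^ 2 * s := by
  by_contra! hb
  have hb2 : 2 * s < b := by
    refine lt_of_le_of_lt ?_ hb
    gcongr
    rw [le_div_iff₀ (by positivity)]
    nlinarith
  set c := δ / 4 with hc
  have hc0 : 0 < c := by positivity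
  set h := b / 4 with hh
  have hh0 : 0 < h := by linarith
  set f : EuclideanSpace ℝ (Fin k) → ℝ≥0∞ := fun x => ν (Metric.closedBall x s) with hf
  have hfm : Measurable f := measurable_measure_closedBall ν s
  have hf0 : 1 / 2 ≤ f 0 := hball
  have hf0' : f 0 ≠ 0 := fun h0 => by rw [h0] at hf0; simp at hf0
  have hftop : ∀ x, f x ≠ ∞ := fun x => measure_ne_top _ _
  set q : ℝ≥0∞ := ENNReal.ofReal (c ^ k) with hq
  set D := {x | q * f 0 ≤ f x} with hD
  have hDm : MeasurableSet D := measurableSet_le measurable_const hfm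
  have hq1 : q ≤ 1 := by
    rw [hq, ← ENNReal.ofReal_one]
    exact ENNReal.ofReal_le_ofReal (pow_le_one₀ hc0.le (by rw [hc]; linarith))
  have h0D : 0 ∈ D := by
    change q * f 0 ≤ f 0
    exact mul_le_of_le_one_left zero_le hq1
  have hDc : Convex ℝ D := by
    rw [convex_iff_forall_pos]
    intro x hx y hy a b' ha hb' hab
    have hb'' : b' = 1 - a := by linarith
    subst hb''
    change q * f 0 ≤ f (a • x + (1 - a) • y)
    have hqf : q * f 0 ≠ 0 := by
      refine mul_ne_zero ?_ hf0'
      rw [hq]; simp only [ne_eq, ENNReal.ofReal_eq_zero, not_le]; positivity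
    have hqf' : q * f 0 ≠ ∞ := ENNReal.mul_ne_top (by simp [hq]) (hftop _)
    calc q * f 0 = (q * f 0) ^ a * (q * f 0) ^ (1 - a) := by
          rw [← ENNReal.rpow_add _ _ hqf hqf']; simp
      _ ≤ f x ^ a * f y ^ (1 - a) := by gcongr <;> assumption
      _ ≤ _ := hν.closedBall_le s ha (by linarith) x y
  set Vs : ℝ≥0∞ := volume (Metric.closedBall (0 : EuclideanSpace ℝ (Fin k)) s) with hVs
  have hvol : ∀ (y : EuclideanSpace ℝ (Fin k)) (r : ℝ), 0 ≤ r →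
      volume (Metric.closedBall y (r * s)) = ENNReal.ofReal (r ^ k) * Vs := by
    intro y r hr
    rw [hVs, Measure.addHaar_closedBall_center, Measure.addHaar_closedBall_mul _ _ hr hs.le]
    simp
  have hVs0 : Vs ≠ 0 := (Metric.measure_closedBall_pos _ _ hs).ne'
  have hVst : Vs ≠ ∞ := measure_closedBall_lt_top.ne
  set D2 := {x : EuclideanSpace ℝ (Fin k) | (1 / 2 : ℝ) • x ∉ D} with hD2
  have hD2m : MeasurableSet D2 := by
    have : Measurable fun x : EuclideanSpace ℝ (Fin k) => (1 / 2 : ℝ) • x := by fun_prop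
    exact (this hDm).compl
  have hD2_le : ∫⁻ x in D2, f x ≤ q * (ENNReal.ofReal (2 ^ k) * Vs) := by
    have h1 : ∀ x ∈ D2, f x ≤ q * f ((1 / 2 : ℝ) • x) := by
      intro x hx
      have hx' : f ((1 / 2 : ℝ) • x) < q * f 0 := not_le.mp hx
      have h2 := hν.closedBall_le s (a := 1 / 2) (by norm_num) (by norm_num) x 0
      have e : (1 / 2 : ℝ) • x + (1 - 1 / 2 : ℝ) • (0 : EuclideanSpace ℝ (Fin k)) =
        (1 / 2 : ℝ) • x := by simp
      rw [e, show (1 - 1 / 2 : ℝ) = 1 / 2 by norm_num] at h2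
      change f x ^ (1 / 2 : ℝ) * f 0 ^ (1 / 2 : ℝ) ≤ f ((1 / 2 : ℝ) • x) at h2
      have h3 : f x * f 0 ≤ f ((1 / 2 : ℝ) • x) ^ 2 := by
        have h4 : (f x ^ (1 / 2 : ℝ) * f 0 ^ (1 / 2 : ℝ)) ^ 2 = f x * f 0 := by
          rw [mul_pow, ← ENNReal.rpow_natCast, ← ENNReal.rpow_natCast, ← ENNReal.rpow_mul,
            ← ENNReal.rpow_mul]
          norm_num
        rw [← h4]; gcongr
      have h5 : f x * f 0 ≤ (q * f ((1 / 2 : ℝ) • x)) * f 0 := by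
        refine h3.trans ?_
        rw [sq, mul_right_comm]
        gcongr
      exact (ENNReal.mul_le_mul_iff_left hf0' (hftop 0)).mp h5
    refine (setLIntegral_mono' hD2m h1).trans ?_
    have hm2 : Measurable fun x : EuclideanSpace ℝ (Fin k) => (2 : ℝ) • x := by fun_prop
    have h6 : ∀ x, f ((1 / 2 : ℝ) • x) =
        (ν.map fun x : EuclideanSpace ℝ (Fin k) => (2 : ℝ) • x) (Metric.closedBall x (2 * s)) := by
      intro x
      exact (map_two_smul_closedBall ν x s).symm
    have : IsProbabilityMeasure (ν.map fun x : EuclideanSpace ℝ (Fin k) => (2 : ℝ) • x) :=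
      Measure.isProbabilityMeasure_map hm2.aemeasurable
    calc ∫⁻ x in D2, q * f ((1 / 2 : ℝ) • x) ≤ ∫⁻ x, q * f ((1 / 2 : ℝ) • x) :=
          setLIntegral_le_lintegral _ _
      _ = q * ∫⁻ x in Set.univ, (ν.map fun x : EuclideanSpace ℝ (Fin k) => (2 : ℝ) • x)
            (Metric.closedBall x (2 * s)) := by
          rw [lintegral_const_mul' _ _ (by simp [hq])]
          simp_rw [h6, Measure.restrict_univ]
      _ ≤ q * (ENNReal.ofReal (2 ^ k) * Vs) := by
          rw [lintegral_measure_closedBall _ _ _ MeasurableSet.univ]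
          simp_rw [Set.univ_inter, hvol _ 2 (by norm_num)]
          simp
  have hD_dir : ∀ t : EuclideanSpace ℝ (Fin k), ‖t‖ = 1 → ∃ x ∈ D, h < |⟪t, x⟫| := by
    intro t ht
    by_contra! hcon
    have h1 : Vs * ν {x | b ≤ |⟪t, x⟫|} ≤ ∫⁻ x in D2, f x := by
      rw [hf, lintegral_measure_closedBall _ _ _ hD2m]
      have hm : MeasurableSet {x : EuclideanSpace ℝ (Fin k) | b ≤ |⟪t, x⟫|} :=
        measurableSet_le (by fun_prop) (by fun_prop)
      rw [← lintegral_indicator_const hm]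
      refine lintegral_mono fun y => ?_
      by_cases hy : b ≤ |⟪t, y⟫|
      · rw [Set.indicator_of_mem (by exact hy)]
        rw [hVs, ← Measure.addHaar_closedBall_center volume y s]
        refine measure_mono fun x hx => ⟨?_, hx⟩
        intro hxD
        have h3 := hcon _ hxD
        rw [inner_smul_right, abs_mul, abs_of_pos (by norm_num : (0 : ℝ) < 1 / 2)] at h3
        have h4 : |⟪t, y - x⟫| ≤ s := by
          refine (abs_real_inner_le_norm _ _).trans ?_
          rw [ht, one_mul, ← dist_eq_norm, dist_comm]
          exact hx
        rw [inner_sub_right] at h4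
        have h5 := abs_sub_abs_le_abs_sub (⟪t, y⟫) (⟪t, x⟫)
        linarith
      · rw [Set.indicator_of_notMem (by exact hy)]
        exact zero_le
    have h2 : Vs * ENNReal.ofReal (δ ^ k) ≤ Vs * ENNReal.ofReal ((δ / 2) ^ k) := by
      calc Vs * ENNReal.ofReal (δ ^ k) ≤ Vs * ν {x | b ≤ |⟪t, x⟫|} := by gcongr; exact hdir t ht
        _ ≤ q * (ENNReal.ofReal (2 ^ k) * Vs) := h1.trans hD2_le
        _ = Vs * (q * ENNReal.ofReal (2 ^ k)) := by ring
        _ = _ := by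
          rw [hq, ← ENNReal.ofReal_mul (by positivity), ← mul_pow]
          rw [show c * 2 = δ / 2 by rw [hc]; ring]
    rw [ENNReal.mul_le_mul_iff_right hVs0 hVst, ENNReal.ofReal_le_ofReal_iff (by positivity)] at h2
    have := pow_lt_pow_left₀ (by linarith : δ / 2 < δ) (by positivity) (by omega : k ≠ 0)
    linarith
  have hball_sub : Metric.ball 0 h ⊆ closure (D - D) := by
    intro z hz
    by_contra hzD
    obtain ⟨F, u, hF, hu⟩ := geometric_hahn_banach_closed_point (hDc.sub hDc).closure
      isClosed_closure hzD
    set w := (InnerProductSpace.toDual ℝ (EuclideanSpace ℝ (Fin k))).symm F with hw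
    have hFw : ∀ x, F x = ⟪w, x⟫ := fun x => by
      rw [hw, InnerProductSpace.toDual_symm_apply]
    have hu0 : 0 < u := by
      have := hF 0 (subset_closure ⟨0, h0D, 0, h0D, by simp⟩)
      simpa using this
    have hw0 : w ≠ 0 := by
      intro h0
      have := hFw z
      rw [h0, inner_zero_left] at this
      linarith
    have hwn : 0 < ‖w‖ := norm_pos_iff.mpr hw0
    obtain ⟨x, hxD, hx⟩ := hD_dir (‖w‖⁻¹ • w) (norm_smul_inv_norm (𝕜 := ℝ) hw0)
    rw [inner_smul_left] at hx
    simp only [conj_trivial, abs_mul, abs_of_pos (inv_pos.mpr hwn)] at hx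
    have h1 := hF x (subset_closure ⟨x, hxD, 0, h0D, by simp⟩)
    have h2 := hF (-x) (subset_closure ⟨0, h0D, x, hxD, by simp⟩)
    rw [hFw] at h1 h2 hu
    rw [inner_neg_right] at h2
    have h3 : |⟪w, x⟫| < u := abs_lt.mpr ⟨by linarith, by linarith⟩
    have h4 : ⟪w, z⟫ ≤ ‖w‖ * ‖z‖ := real_inner_le_norm _ _
    have h5 : ‖z‖ < h := by simpa using hz
    rw [inv_mul_eq_div, lt_div_iff₀ hwn] at hx
    nlinarith
  set ρ := (ν.prod ν).map fun p : EuclideanSpace ℝ (Fin k) × EuclideanSpace ℝ (Fin k) =>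
    p.1 - p.2 with hρ
  have hsubm : Measurable fun p : EuclideanSpace ℝ (Fin k) × EuclideanSpace ℝ (Fin k) =>
    p.1 - p.2 := by fun_prop
  have : IsProbabilityMeasure ρ := Measure.isProbabilityMeasure_map hsubm.aemeasurable
  have hball_mass : ∀ z ∈ Metric.ball (0 : EuclideanSpace ℝ (Fin k)) h,
      ENNReal.ofReal ((c ^ 2 / 4) ^ k) ≤ ρ (Metric.closedBall z (3 * s)) := by
    intro z hz
    obtain ⟨_, ⟨x, hx, y, hy, rfl⟩, hd⟩ := Metric.mem_closure_iff.mp (hball_sub hz) s hs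
    rw [hρ, Measure.map_apply hsubm measurableSet_closedBall]
    have hsub : Metric.closedBall x s ×ˢ Metric.closedBall y s ⊆
        (fun p : EuclideanSpace ℝ (Fin k) × EuclideanSpace ℝ (Fin k) => p.1 - p.2) ⁻¹'
          Metric.closedBall z (3 * s) := by
      rintro ⟨u, v⟩ ⟨hu, hv⟩
      simp only [Set.mem_preimage, mem_closedBall_iff_norm] at hu hv ⊢
      rw [dist_eq_norm] at hd
      have e : u - v - z = (u - x) - (v - y) - (z - (x - y)) := by abel
      rw [e]
      have h1 := norm_sub_le ((u - x) - (v - y)) (z - (x - y))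
      have h2 := norm_sub_le (u - x) (v - y)
      dsimp only at hd
      linarith
    refine le_trans ?_ (measure_mono hsub)
    rw [Measure.prod_prod]
    have hq2 : ENNReal.ofReal ((c ^ 2 / 4) ^ k) ≤ (q * (1 / 2)) * (q * (1 / 2)) := by
      rw [hq, one_div, ← ENNReal.ofReal_ofNat 2, ← ENNReal.ofReal_inv_of_pos (by norm_num),
        ← ENNReal.ofReal_mul (by positivity), ← ENNReal.ofReal_mul (by positivity)]
      apply ENNReal.ofReal_le_ofReal
      have h1 : (1 / 4 : ℝ) ^ k ≤ 1 / 4 := by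
        calc (1 / 4 : ℝ) ^ k ≤ (1 / 4) ^ 1 := pow_le_pow_of_le_one (by norm_num) (by norm_num) hk
          _ = _ := by norm_num
      calc (c ^ 2 / 4) ^ k = (c ^ k) ^ 2 * (1 / 4) ^ k := by
            rw [← pow_mul, mul_comm k 2, pow_mul, ← mul_pow]; ring
        _ ≤ (c ^ k) ^ 2 * (1 / 4) := by gcongr
        _ = _ := by ring
    refine hq2.trans ?_
    have hx' : q * f 0 ≤ f x := hx
    have hy' : q * f 0 ≤ f y := hy
    calc q * (1 / 2) * (q * (1 / 2)) ≤ q * f 0 * (q * f 0) := by gcongr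
      _ ≤ f x * f y := by gcongr
  have h7 : ENNReal.ofReal ((c ^ 2 / 4) ^ k) * volume (Metric.ball (0 : EuclideanSpace ℝ (Fin k)) h)
      ≤ ENNReal.ofReal (3 ^ k) * Vs := by
    calc ENNReal.ofReal ((c ^ 2 / 4) ^ k) * volume (Metric.ball (0 : EuclideanSpace ℝ (Fin k)) h)
        = ∫⁻ z in Metric.ball (0 : EuclideanSpace ℝ (Fin k)) h, ENNReal.ofReal ((c ^ 2 / 4) ^ k) := by
          rw [setLIntegral_const]
      _ ≤ ∫⁻ z in Metric.ball (0 : EuclideanSpace ℝ (Fin k)) h, ρ (Metric.closedBall z (3 * s)) :=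
          setLIntegral_mono' measurableSet_ball hball_mass
      _ = ∫⁻ y, volume (Metric.ball (0 : EuclideanSpace ℝ (Fin k)) h ∩
            Metric.closedBall y (3 * s)) ∂ρ :=
          lintegral_measure_closedBall _ _ _ measurableSet_ball _
      _ ≤ ∫⁻ _, ENNReal.ofReal (3 ^ k) * Vs ∂ρ := by
          refine lintegral_mono fun y => (measure_mono Set.inter_subset_right).trans ?_
          rw [hvol y 3 (by norm_num)]
      _ = _ := by simp
  have : Nontrivial (EuclideanSpace ℝ (Fin k)) :=
    Module.nontrivial_of_finrank_pos (R := ℝ) (by simp; omega)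
  rw [show Metric.ball (0 : EuclideanSpace ℝ (Fin k)) h = Metric.ball 0 ((h / s) * s) by
      rw [div_mul_cancel₀ _ hs.ne'],
    Measure.addHaar_ball_mul _ _ (by positivity), Measure.addHaar_ball _ _ hs.le,
    hVs, Measure.addHaar_closedBall _ _ hs.le] at h7
  simp only [finrank_euclideanSpace, Fintype.card_fin] at h7
  rw [← mul_assoc (ENNReal.ofReal ((c ^ 2 / 4) ^ k)), ← ENNReal.ofReal_mul (by positivity),
    ENNReal.mul_le_mul_iff_left, ENNReal.ofReal_le_ofReal_iff (by positivity), ← mul_pow] at h7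
  · have h8 := le_of_pow_le_pow_left₀ (by omega) (by norm_num) h7
    have h9 : c ^ 2 / 4 * (h / s) = δ ^ 2 * b / (256 * s) := by
      rw [hc, hh]; field_simp; ring
    rw [h9, div_le_iff₀ (by positivity)] at h8
    have h10 : 768 / δ ^ 2 * s * δ ^ 2 = 768 * s := by field_simp
    have h11 : 768 / δ ^ 2 * s * δ ^ 2 < b * δ ^ 2 := by gcongr
    linarith
  · refine mul_ne_zero ?_ (Metric.measure_ball_pos _ _ one_pos).ne'
    simp only [ne_eq, ENNReal.ofReal_eq_zero, not_le]; positivity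
  · exact ENNReal.mul_ne_top (by simp) measure_ball_lt_top.ne

/-- A quantitative Paley-Zygmund inequality. -/
lemma paley_zygmund {α : Type*} [MeasurableSpace α] {μ : Measure α} [IsProbabilityMeasure μ]
    {Z : α → ℝ≥0∞} (hZ : Measurable Z) {w K : ℝ} (hw : 0 < w) (hK : 0 < K)
    (h1 : ENNReal.ofReal w ≤ ∫⁻ x, Z x ∂μ) (h2 : ∫⁻ x, Z x ^ 2 ∂μ ≤ ENNReal.ofReal (K * w ^ 2)) :
    ENNReal.ofReal (1 / (4 * K)) ≤ μ {x | ENNReal.ofReal (w / 2) ≤ Z x} := by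
  set A := {x | ENNReal.ofReal (w / 2) ≤ Z x} with hA
  have hAm : MeasurableSet A := measurableSet_le measurable_const hZ
  set a := 1 / (4 * K * w) with ha
  have ha0 : 0 < a := by positivity
  have hpt : ∀ x, Z x ≤ ENNReal.ofReal (w / 2) + ENNReal.ofReal a * Z x ^ 2 +
      A.indicator (fun _ => ENNReal.ofReal (1 / (4 * a))) x := by
    intro x
    by_cases hx : x ∈ A
    · rw [Set.indicator_of_mem hx]
      rcases eq_or_ne (Z x) ∞ with hi | hi
      · rw [hi]; simp [ENNReal.mul_top, ha0]
      · lift Z x to NNReal using hi with z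
        rw [← ENNReal.ofReal_coe_nnreal, ← ENNReal.ofReal_pow z.coe_nonneg,
          ← ENNReal.ofReal_mul ha0.le, ← ENNReal.ofReal_add (by positivity) (by positivity),
          ← ENNReal.ofReal_add (by positivity) (by positivity)]
        apply ENNReal.ofReal_le_ofReal
        have : (z : ℝ) ≤ a * z ^ 2 + 1 / (4 * a) := by
          have : a * z ^ 2 + 1 / (4 * a) - z = (2 * a * z - 1) ^ 2 / (4 * a) := by
            field_simp; ring
          have h3 : 0 ≤ (2 * a * z - 1) ^ 2 / (4 * a) := by positivity
          linarith
        linarith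
    · exact (not_le.mp hx).le.trans (by rw [add_assoc]; exact le_self_add)
  have h3 : ENNReal.ofReal w ≤ ENNReal.ofReal (w / 2) + ENNReal.ofReal a *
      ENNReal.ofReal (K * w ^ 2) + ENNReal.ofReal (1 / (4 * a)) * μ A := by
    refine h1.trans ((lintegral_mono hpt).trans ?_)
    rw [lintegral_add_left (by fun_prop), lintegral_add_left (by fun_prop),
      lintegral_const_mul _ (by fun_prop), lintegral_indicator_const hAm]
    simp only [lintegral_const, measure_univ, mul_one]
    gcongr
  have h4 := measure_ne_top μ A
  rw [← ENNReal.ofReal_toReal h4, ← ENNReal.ofReal_mul (by positivity),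
    ← ENNReal.ofReal_mul (by positivity), ← ENNReal.ofReal_add (by positivity) (by positivity),
    ← ENNReal.ofReal_add (by positivity) (by positivity),
    ENNReal.ofReal_le_ofReal_iff (by positivity)] at h3
  rw [ENNReal.ofReal_le_iff_le_toReal h4]
  have e1 : a * (K * w ^ 2) = w / 4 := by rw [ha]; field_simp
  have e2 : 1 / (4 * a) = K * w := by rw [ha]; field_simp
  rw [e1, e2] at h3
  rw [div_le_iff₀ (by positivity)]
  nlinarith

lemma LogConcaveMeasure.exists_lower_tail :
    ∃ δ : ℝ, 0 < δ ∧ δ ≤ 1 ∧ ∀ {V : Type} [NormedAddCommGroup V] [NormedSpace ℝ V]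
      [MeasurableSpace V] [OpensMeasurableSpace V] {ν : Measure V} [IsProbabilityMeasure ν],
      LogConcaveMeasure ν → ∀ {k : ℕ} {b M : ℝ}, 1 ≤ k → 0 < b →
      ENNReal.ofReal (b ^ k) ≤ ∫⁻ x, ‖x‖ₑ ^ k ∂ν → ∫⁻ x, ‖x‖ₑ ^ k ∂ν ≤ ENNReal.ofReal M →
      ENNReal.ofReal (δ ^ k) ≤ ν {x | b / 2 ≤ ‖x‖} := by
  obtain ⟨K, hK1, hK⟩ := LogConcaveMeasure.exists_moment_le
  refine ⟨1 / (16 * K ^ 2), by positivity, ?_, ?_⟩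
  · rw [div_le_one (by positivity)]; nlinarith
  intro V _ _ _ _ ν _ hν k b M hk hb hlow hup
  have hk' : (1 : ℝ) ≤ k := by exact_mod_cast hk
  have hfin : ∫⁻ x, ‖x‖ₑ ^ k ∂ν ≠ ∞ := (hup.trans_lt ENNReal.ofReal_lt_top).ne
  set w := (∫⁻ x, ‖x‖ₑ ^ k ∂ν).toReal with hw
  have hwe : ∫⁻ x, ‖x‖ₑ ^ k ∂ν = ENNReal.ofReal w := (ENNReal.ofReal_toReal hfin).symm
  rw [hwe] at hlow
  have hbw : b ^ k ≤ w := by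
    rwa [ENNReal.ofReal_le_ofReal_iff ENNReal.toReal_nonneg] at hlow
  have hw0 : 0 < w := lt_of_lt_of_le (by positivity) hbw
  set m := w ^ (1 / (k : ℝ)) with hm
  have hm0 : 0 < m := by positivity
  have hmk : m ^ k = w := by
    rw [hm, ← Real.rpow_natCast, ← Real.rpow_mul hw0.le]
    rw [one_div_mul_cancel (by positivity), Real.rpow_one]
  have h1 := hK hν (p := k) (q := (2 * k : ℕ)) (M := m) hk' (by push_cast; linarith) hm0 (by
    simp only [ENNReal.rpow_natCast, Real.rpow_natCast, hmk]; exact hwe.le)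
  simp only [ENNReal.rpow_natCast, Real.rpow_natCast] at h1
  have e : K * (((2 * k : ℕ) : ℝ) / k) * m = 2 * K * m := by
    push_cast; field_simp
  rw [e] at h1
  have h2 := paley_zygmund (μ := ν) (Z := fun x => ‖x‖ₑ ^ k) (by fun_prop) hw0
    (K := (4 * K ^ 2) ^ k) (by positivity) hwe.ge (by
      simp only [← pow_mul]
      rw [mul_comm k 2]
      refine h1.trans (ENNReal.ofReal_le_ofReal ?_)
      rw [← hmk, ← pow_mul, mul_comm k 2, pow_mul, pow_mul m, ← mul_pow]
      apply le_of_eq; ring)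
  refine le_trans ?_ (h2.trans (measure_mono ?_))
  · apply ENNReal.ofReal_le_ofReal
    rw [show (1 / (16 * K ^ 2)) = (1 / 4) * (1 / (4 * K ^ 2)) by field_simp; norm_num, mul_pow]
    have h1 : (1 / 4 : ℝ) ^ k ≤ 1 / 4 := by
      calc (1 / 4 : ℝ) ^ k ≤ (1 / 4) ^ 1 := pow_le_pow_of_le_one (by norm_num) (by norm_num) hk
        _ = _ := by norm_num
    calc _ ≤ 1 / 4 * (1 / (4 * K ^ 2)) ^ k := by gcongr
      _ = _ := by rw [div_pow, one_pow]; field_simp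
  · intro x hx
    simp only [Set.mem_ofPred_eq] at hx ⊢
    rw [← ofReal_norm, ← ENNReal.ofReal_pow (norm_nonneg _),
      ENNReal.ofReal_le_ofReal_iff (by positivity)] at hx
    have h3 : (b / 2) ^ k ≤ ‖x‖ ^ k := by
      refine le_trans ?_ hx
      rw [div_pow]
      have h4 : (2 : ℝ) ≤ 2 ^ k := by
        calc (2 : ℝ) = 2 ^ 1 := by norm_num
          _ ≤ _ := pow_le_pow_right₀ (by norm_num) hk
      calc b ^ k / 2 ^ k ≤ b ^ k / 2 := by gcongr
        _ ≤ _ := by gcongr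
    exact le_of_pow_le_pow_left₀ (by omega) (norm_nonneg _) h3

lemma volume_preimage_two_mul_sub (K : Set ℝ) (b : ℝ) :
    volume ((fun z : ℝ => 2 * z - b) ⁻¹' K) = volume K / 2 := by
  have : (fun z : ℝ => 2 * z - b) ⁻¹' K = (fun z => 2 * z) ⁻¹' ((fun z => z - b) ⁻¹' K) := rfl
  rw [this, Real.volume_preimage_mul_left two_ne_zero]
  simp_rw [sub_eq_add_neg]
  rw [measure_preimage_add_right, abs_of_pos (by norm_num), ENNReal.ofReal_inv_of_pos two_pos,
    mul_comm, div_eq_mul_inv]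
  simp

lemma volume_add_le_of_isCompact {K L D : Set ℝ} (hK : IsCompact K) (hL : IsCompact L)
    (hK0 : K.Nonempty) (hL0 : L.Nonempty) (h : ∀ x ∈ K, ∀ y ∈ L, (x + y) / 2 ∈ D) :
    volume K + volume L ≤ 2 * volume D := by
  obtain ⟨a, haK, ha⟩ := hK.exists_isGreatest hK0
  obtain ⟨b, hbL, hb⟩ := hL.exists_isLeast hL0
  set K' := (fun z : ℝ => 2 * z - b) ⁻¹' K
  set L' := (fun z : ℝ => 2 * z - a) ⁻¹' L
  have hK' : K' ⊆ D := by
    intro z hz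
    have := h _ hz _ hbL
    simpa using this
  have hL' : L' ⊆ D := by
    intro z hz
    have := h _ haK _ hz
    simpa using this
  have hdis : AEDisjoint volume K' L' := by
    refine measure_mono_null (t := {(a + b) / 2}) ?_ (by simp)
    rintro z ⟨hz1, hz2⟩
    have h1 := ha hz1
    have h2 := hb hz2
    simp only at h1 h2
    simp only [Set.mem_singleton_iff]
    linarith
  have hLm : MeasurableSet L' := hL.measurableSet.preimage (by fun_prop)
  have h1 := measure_union₀ hLm.nullMeasurableSet hdis
  have h2 := measure_mono (μ := volume) (Set.union_subset hK' hL')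
  rw [h1, volume_preimage_two_mul_sub, volume_preimage_two_mul_sub, ENNReal.div_add_div_same] at h2
  rwa [ENNReal.div_le_iff' (by norm_num) (by norm_num)] at h2

/-- The one-dimensional Brunn-Minkowski inequality for midpoints. -/
lemma volume_add_le_of_midpoints {A B D : Set ℝ} (hA : MeasurableSet A) (hB : MeasurableSet B)
    (hA0 : A.Nonempty) (hB0 : B.Nonempty) (h : ∀ x ∈ A, ∀ y ∈ B, (x + y) / 2 ∈ D) :
    volume A + volume B ≤ 2 * volume D := by
  obtain ⟨x, hx⟩ := hA0
  obtain ⟨y, hy⟩ := hB0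
  rw [hA.measure_eq_iSup_isCompact, hB.measure_eq_iSup_isCompact]
  simp only [iSup_and']
  refine ENNReal.biSup_add_biSup_le' ⟨∅, by simp⟩ ⟨∅, by simp⟩ ?_
  rintro K ⟨hKA, hK⟩ L ⟨hLB, hL⟩
  refine le_trans ?_ (volume_add_le_of_isCompact (K := insert x K) (L := insert y L)
    (hK.insert x) (hL.insert y) (by simp) (by simp) ?_)
  · gcongr <;> simp
  · intro u hu v hv
    exact h _ (Set.insert_subset hx hKA hu) _ (Set.insert_subset hy hLB hv)

/-- A midpoint version of the one-dimensional Prékopa-Leindler inequality. -/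
lemma lintegral_mul_lintegral_le {u v : ℝ → ℝ≥0∞} {h : ℝ → ℝ} (hu : Measurable u)
    (hv : Measurable v) (hh : Measurable h) (h0 : ∀ x, 0 ≤ h x) (h1 : ∀ x, h x ≤ 1)
    (H : ∀ x y, u x * v y ≤ ENNReal.ofReal (h ((x + y) / 2) ^ 2)) :
    (∫⁻ x, u x) * ∫⁻ x, v x ≤ (∫⁻ x, ENNReal.ofReal (h x)) ^ 2 := by
  have hab : (⨆ x, u x) * ⨆ x, v x ≤ 1 := by
    simp_rw [ENNReal.iSup_mul, ENNReal.mul_iSup]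
    refine iSup_le fun x => iSup_le fun y => (H x y).trans ?_
    rw [← ENNReal.ofReal_one]
    exact ENNReal.ofReal_le_ofReal (pow_le_one₀ (h0 _) (h1 _))
  set a := ⨆ x, u x with ha
  set b := ⨆ x, v x with hb
  rcases eq_or_ne a 0 with ha0 | ha0
  · have : ∀ x, u x = 0 := fun x => by
      have := le_iSup u x
      rw [← ha, ha0] at this
      simpa using this
    simp [this]
  rcases eq_or_ne b 0 with hb0 | hb0
  · have : ∀ x, v x = 0 := fun x => by
      have := le_iSup v x
      rw [← hb, hb0] at this
      simpa using this
    simp [this]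
  have hat : a ≠ ∞ := by
    intro h; rw [h, ENNReal.top_mul hb0] at hab; simp at hab
  have hbt : b ≠ ∞ := by
    intro h; rw [h, ENNReal.mul_top ha0] at hab; simp at hab
  have hut : ∀ x, u x ≠ ∞ := fun x => ((le_iSup u x).trans_lt hat.lt_top).ne
  have hvt : ∀ x, v x ≠ ∞ := fun x => ((le_iSup v x).trans_lt hbt.lt_top).ne
  set α := a.toReal with hα
  set β := b.toReal with hβ
  have hα0 : 0 < α := ENNReal.toReal_pos ha0 hat
  have hβ0 : 0 < β := ENNReal.toReal_pos hb0 hbt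
  set r := √(α * β) with hr
  have hr0 : 0 < r := by positivity
  have hr2 : r ^ 2 = α * β := Real.sq_sqrt (by positivity)
  set U : ℝ → ℝ := fun x => (u x).toReal / α with hU
  set W : ℝ → ℝ := fun x => (v x).toReal / β with hW
  have hUm : Measurable U := by fun_prop
  have hWm : Measurable W := by fun_prop
  have hU0 : ∀ x, 0 ≤ U x := fun x => by positivity
  have hW0 : ∀ x, 0 ≤ W x := fun x => by positivity
  have hUe : ∀ s < 1, 0 < s → ∃ x, s < U x := by
    intro s hs hs0
    have : ENNReal.ofReal (s * α) < ⨆ x, u x := by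
      rw [← ha, ENNReal.ofReal_lt_iff_lt_toReal (by positivity) hat]
      nlinarith
    obtain ⟨x, hx⟩ := lt_iSup_iff.mp this
    refine ⟨x, ?_⟩
    rw [ENNReal.ofReal_lt_iff_lt_toReal (by positivity) (hut x)] at hx
    rwa [hU, lt_div_iff₀ hα0]
  have hWe : ∀ s < 1, 0 < s → ∃ x, s < W x := by
    intro s hs hs0
    have : ENNReal.ofReal (s * β) < ⨆ x, v x := by
      rw [← hb, ENNReal.ofReal_lt_iff_lt_toReal (by positivity) hbt]
      nlinarith
    obtain ⟨x, hx⟩ := lt_iSup_iff.mp this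
    refine ⟨x, ?_⟩
    rw [ENNReal.ofReal_lt_iff_lt_toReal (by positivity) (hvt x)] at hx
    rwa [hW, lt_div_iff₀ hβ0]
  have hU1 : ∀ x, U x ≤ 1 := fun x => by
    rw [hU, div_le_one hα0]
    exact ENNReal.toReal_mono hat (le_iSup u x)
  have hW1 : ∀ x, W x ≤ 1 := fun x => by
    rw [hW, div_le_one hβ0]
    exact ENNReal.toReal_mono hbt (le_iSup v x)
  have hlev : ∀ s, 0 < s → volume {x | s < U x} + volume {x | s < W x} ≤
      2 * volume {x | s < h x / r} := by
    intro s hs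
    rcases lt_or_ge s 1 with hs1 | hs1
    · refine volume_add_le_of_midpoints (measurableSet_lt measurable_const hUm)
        (measurableSet_lt measurable_const hWm) (hUe s hs1 hs) (hWe s hs1 hs) ?_
      intro x hx y hy
      simp only [Set.mem_ofPred_eq] at hx hy ⊢
      have h2 := ENNReal.toReal_mono (by simp) (H x y)
      rw [ENNReal.toReal_mul, ENNReal.toReal_ofReal (by positivity)] at h2
      rw [lt_div_iff₀ hr0]
      refine lt_of_pow_lt_pow_left₀ 2 (h0 _) (lt_of_lt_of_le ?_ h2)
      rw [hU, lt_div_iff₀ hα0] at hx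
      rw [hW, lt_div_iff₀ hβ0] at hy
      calc (s * r) ^ 2 = (s * α) * (s * β) := by rw [mul_pow, hr2]; ring
        _ < _ := by gcongr
    · have e1 : {x | s < U x} = ∅ := by
        ext x; simp only [Set.mem_ofPred_eq, Set.mem_empty_iff_false, iff_false, not_lt]
        exact (hU1 x).trans hs1
      have e2 : {x | s < W x} = ∅ := by
        ext x; simp only [Set.mem_ofPred_eq, Set.mem_empty_iff_false, iff_false, not_lt]
        exact (hW1 x).trans hs1
      rw [e1, e2]; simp
  have hsum : (∫⁻ x, ENNReal.ofReal (U x)) + ∫⁻ x, ENNReal.ofReal (W x) ≤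
      2 * ∫⁻ x, ENNReal.ofReal (h x / r) := by
    rw [lintegral_eq_lintegral_meas_lt volume (.of_forall hU0) hUm.aemeasurable,
      lintegral_eq_lintegral_meas_lt volume (.of_forall hW0) hWm.aemeasurable,
      lintegral_eq_lintegral_meas_lt volume (.of_forall fun x => div_nonneg (h0 x) hr0.le)
        (by fun_prop)]
    have hanti : ∀ f : ℝ → ℝ, Measurable fun t => volume {x | t < f x} := fun f =>
      Antitone.measurable fun s t hst => measure_mono fun x hx => lt_of_le_of_lt hst hx
    rw [← lintegral_add_left (hanti _), ← lintegral_const_mul _ (hanti _)]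
    exact setLIntegral_mono' measurableSet_Ioi fun s hs => hlev s hs
  have eU : ∫⁻ x, u x = ENNReal.ofReal α * ∫⁻ x, ENNReal.ofReal (U x) := by
    rw [← lintegral_const_mul _ (by fun_prop)]
    refine lintegral_congr fun x => ?_
    rw [← ENNReal.ofReal_mul hα0.le, hU, mul_div_cancel₀ _ hα0.ne', ENNReal.ofReal_toReal (hut x)]
  have eW : ∫⁻ x, v x = ENNReal.ofReal β * ∫⁻ x, ENNReal.ofReal (W x) := by
    rw [← lintegral_const_mul _ (by fun_prop)]
    refine lintegral_congr fun x => ?_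
    rw [← ENNReal.ofReal_mul hβ0.le, hW, mul_div_cancel₀ _ hβ0.ne', ENNReal.ofReal_toReal (hvt x)]
  have eH : ∫⁻ x, ENNReal.ofReal (h x) = ENNReal.ofReal r * ∫⁻ x, ENNReal.ofReal (h x / r) := by
    rw [← lintegral_const_mul _ (by fun_prop)]
    refine lintegral_congr fun x => ?_
    rw [← ENNReal.ofReal_mul hr0.le, mul_div_cancel₀ _ hr0.ne']
  rw [eU, eW, eH, mul_pow, ← ENNReal.ofReal_pow hr0.le, hr2, ENNReal.ofReal_mul hα0.le,
    mul_mul_mul_comm]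
  gcongr
  generalize (∫⁻ x, ENNReal.ofReal (U x)) = p at *
  generalize (∫⁻ x, ENNReal.ofReal (W x)) = q at *
  generalize (∫⁻ x, ENNReal.ofReal (h x / r)) = z at *
  rcases eq_or_ne z ∞ with hz | hz
  · simp [hz]
  have hz2 : p + q ≠ ∞ := (hsum.trans_lt (ENNReal.mul_lt_top (by simp) hz.lt_top)).ne
  lift z to NNReal using hz
  lift p to NNReal using fun h => hz2 (by simp [h])
  lift q to NNReal using fun h => hz2 (by simp [h])
  norm_cast at hsum ⊢
  rw [← NNReal.coe_le_coe] at hsum ⊢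
  push_cast at hsum ⊢
  nlinarith [sq_nonneg ((p : ℝ) - q), p.2, q.2, z.2]

/-- The property `(τ)` of the one-dimensional standard Gaussian measure. -/
lemma gaussianReal_lintegral_mul_le_one {f g : ℝ → ℝ≥0∞} (hf : Measurable f) (hg : Measurable g)
    (H : ∀ x y, f x * g y ≤ ENNReal.ofReal (exp ((x - y) ^ 2 / 4))) :
    (∫⁻ x, f x ∂gaussianReal 0 1) * ∫⁻ x, g x ∂gaussianReal 0 1 ≤ 1 := by
  rw [gaussianReal_of_var_ne_zero _ one_ne_zero,
    lintegral_withDensity_eq_lintegral_mul _ (measurable_gaussianPDF 0 1) hf,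
    lintegral_withDensity_eq_lintegral_mul _ (measurable_gaussianPDF 0 1) hg]
  have hdef : ∀ x, gaussianPDFReal 0 1 x = (√(2 * π))⁻¹ * exp (-x ^ 2 / 2) := fun x => by
    simp [gaussianPDFReal_def]
  refine (lintegral_mul_lintegral_le (h := gaussianPDFReal 0 1) (by fun_prop) (by fun_prop)
    (measurable_gaussianPDFReal 0 1) (gaussianPDFReal_nonneg 0 1) ?_ ?_).trans ?_
  · intro x
    rw [hdef]
    refine mul_le_one₀ (inv_le_one_of_one_le₀ ?_) (exp_pos _).le ?_
    · rw [Real.one_le_sqrt]; linarith [Real.pi_gt_three]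
    · rw [Real.exp_le_one_iff]; nlinarith [sq_nonneg x]
  · intro x y
    simp only [Pi.mul_apply, gaussianPDF]
    rw [mul_mul_mul_comm, ← ENNReal.ofReal_mul (gaussianPDFReal_nonneg 0 1 x)]
    refine (mul_le_mul_right (H x y) _).trans (le_of_eq ?_)
    rw [← ENNReal.ofReal_mul (mul_nonneg (gaussianPDFReal_nonneg 0 1 x)
      (gaussianPDFReal_nonneg 0 1 y)), hdef, hdef, hdef]
    congr 1
    have e : exp (-((x + y) / 2) ^ 2 / 2) ^ 2 =
        exp (-x ^ 2 / 2) * exp (-y ^ 2 / 2) * exp ((x - y) ^ 2 / 4) := by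
      rw [← Real.exp_add, ← Real.exp_add, ← Real.exp_nat_mul]
      congr 1; push_cast; ring
    rw [mul_pow, e]; ring
  · have := lintegral_gaussianPDF_eq_one 0 (v := 1) one_ne_zero
    simp only [gaussianPDF] at this
    rw [this, one_pow]

/-- The property `(τ)` of the standard Gaussian product measure. -/
lemma pi_gaussianReal_lintegral_mul_le_one : ∀ (N : ℕ) {f g : (Fin N → ℝ) → ℝ≥0∞},
    Measurable f → Measurable g →
    (∀ x y, f x * g y ≤ ENNReal.ofReal (exp ((∑ i, (x i - y i) ^ 2) / 4))) →
    (∫⁻ x, f x ∂Measure.pi fun _ => gaussianReal 0 1) *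
      ∫⁻ x, g x ∂Measure.pi (fun _ => gaussianReal 0 1) ≤ 1
  | 0, f, g, _, _, H => by
    rw [lintegral_unique, lintegral_unique]
    have h1 := H default default
    rw [Finset.univ_eq_empty, Finset.sum_empty, zero_div, Real.exp_zero, ENNReal.ofReal_one] at h1
    simp only [measure_univ, mul_one]
    convert h1
  | N + 1, f, g, hf, hg, H => by
    have hmp := (measurePreserving_piFinSuccAbove (fun _ : Fin (N + 1) => gaussianReal 0 1) 0).symm
    set e := (MeasurableEquiv.piFinSuccAbove (fun _ : Fin (N + 1) => ℝ) 0).symm with he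
    rw [← hmp.lintegral_comp hf, ← hmp.lintegral_comp hg,
      lintegral_prod (fun p => f (e p)) (hf.comp e.measurable).aemeasurable,
      lintegral_prod (fun p => g (e p)) (hg.comp e.measurable).aemeasurable]
    have hf' : Measurable fun p => f (e p) := hf.comp e.measurable
    have hg' : Measurable fun p => g (e p) := hg.comp e.measurable
    refine gaussianReal_lintegral_mul_le_one hf'.lintegral_prod_right' hg'.lintegral_prod_right' ?_
    intro a b
    have hfa : Measurable fun x => f (e (a, x)) := hf'.comp measurable_prodMk_left
    have hgb : Measurable fun x => g (e (b, x)) := hg'.comp measurable_prodMk_left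
    have h1 := pi_gaussianReal_lintegral_mul_le_one N
      (f := fun x => ENNReal.ofReal (exp (-((a - b) ^ 2 / 4))) * f (e (a, x)))
      (g := fun x => g (e (b, x))) (hfa.const_mul _) hgb ?_
    · rw [lintegral_const_mul _ hfa, mul_assoc] at h1
      have h2 := mul_le_mul_right h1 (ENNReal.ofReal (exp ((a - b) ^ 2 / 4)))
      rwa [← mul_assoc, ← ENNReal.ofReal_mul (exp_pos _).le, ← Real.exp_add, add_neg_cancel,
        Real.exp_zero, ENNReal.ofReal_one, one_mul, mul_one] at h2
    · intro x y
      rw [mul_assoc]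
      refine (mul_le_mul_right (H _ _) _).trans ?_
      rw [← ENNReal.ofReal_mul (exp_pos _).le, ← Real.exp_add, Fin.sum_univ_succ]
      refine ENNReal.ofReal_le_ofReal (Real.exp_le_exp.mpr (le_of_eq ?_))
      simp [he, MeasurableEquiv.piFinSuccAbove, Fin.insertNthEquiv]
      ring

/-- Gaussian concentration: sets at distance `ρ` from each other have small measure product. -/
lemma stdGaussian_mul_le_of_dist {n : ℕ} {A B : Set (EuclideanSpace ℝ (Fin n))} {ρ : ℝ}
    (hA : MeasurableSet A) (hB : MeasurableSet B) (hρ : 0 ≤ ρ)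
    (h : ∀ x ∈ A, ∀ y ∈ B, ρ ≤ ‖x - y‖) :
    stdGaussian (EuclideanSpace ℝ (Fin n)) A * stdGaussian (EuclideanSpace ℝ (Fin n)) B ≤
      ENNReal.ofReal (exp (-(ρ ^ 2 / 4))) := by
  rw [← map_pi_eq_stdGaussian]
  have hm : Measurable (WithLp.toLp 2 : (Fin n → ℝ) → EuclideanSpace ℝ (Fin n)) := by fun_prop
  rw [Measure.map_apply hm hA, Measure.map_apply hm hB]
  have h1 := pi_gaussianReal_lintegral_mul_le_one n
    (f := fun x => ENNReal.ofReal (exp (ρ ^ 2 / 4)) *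
      (WithLp.toLp 2 ⁻¹' A : Set (Fin n → ℝ)).indicator 1 x)
    (g := (WithLp.toLp 2 ⁻¹' B : Set (Fin n → ℝ)).indicator 1)
    (measurable_const.mul (measurable_one.indicator (hm hA))) (measurable_one.indicator (hm hB)) ?_
  · rw [lintegral_const_mul _ (measurable_one.indicator (hm hA)),
      lintegral_indicator_one (hm hA), lintegral_indicator_one (hm hB), mul_assoc] at h1
    have h2 := mul_le_mul_right h1 (ENNReal.ofReal (exp (-(ρ ^ 2 / 4))))
    rwa [← mul_assoc, ← ENNReal.ofReal_mul (exp_pos _).le, ← Real.exp_add, neg_add_cancel,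
      Real.exp_zero, ENNReal.ofReal_one, one_mul, mul_one] at h2
  · intro x y
    by_cases hx : WithLp.toLp 2 x ∈ A
    · by_cases hy : WithLp.toLp 2 y ∈ B
      · rw [Set.indicator_of_mem (by exact hx), Set.indicator_of_mem (by exact hy)]
        simp only [Pi.one_apply, mul_one]
        refine ENNReal.ofReal_le_ofReal (Real.exp_le_exp.mpr ?_)
        have h3 := pow_le_pow_left₀ hρ (h _ hx _ hy) 2
        rw [EuclideanSpace.real_norm_sq_eq] at h3
        simp only [PiLp.sub_apply] at h3
        linarith
      · rw [Set.indicator_of_notMem (s := WithLp.toLp 2 ⁻¹' B) (by exact hy), mul_zero]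
        exact zero_le
    · rw [Set.indicator_of_notMem (by exact hx), mul_zero, zero_mul]
      exact zero_le

lemma map_inner_stdGaussian {n : ℕ} (x : EuclideanSpace ℝ (Fin n)) :
    (stdGaussian (EuclideanSpace ℝ (Fin n))).map (fun z => ⟪x, z⟫) =
      gaussianReal 0 (‖x‖₊ ^ 2) := by
  have h1 := IsGaussian.map_eq_gaussianReal (μ := stdGaussian (EuclideanSpace ℝ (Fin n)))
    (innerSL ℝ x)
  rw [integral_strongDual_stdGaussian, variance_dual_stdGaussian] at h1
  simp only [innerSL_apply_norm] at h1
  rw [Real.toNNReal_pow (norm_nonneg _), norm_toNNReal] at h1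
  exact h1

/-- A linear combination with coefficients in the unit sphere of independent standard Gaussian
vectors is a standard Gaussian vector. -/
lemma map_sum_smul_pi_stdGaussian {k n : ℕ} {t : EuclideanSpace ℝ (Fin k)} (ht : ‖t‖ = 1) :
    (Measure.pi fun _ : Fin k => stdGaussian (EuclideanSpace ℝ (Fin n))).map
      (fun Γ => ∑ j, t j • Γ j) = stdGaussian (EuclideanSpace ℝ (Fin n)) := by
  have hm : Measurable fun Γ : Fin k → EuclideanSpace ℝ (Fin n) => ∑ j, t j • Γ j := by fun_prop
  have : IsProbabilityMeasure ((Measure.pi fun _ : Fin k =>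
      stdGaussian (EuclideanSpace ℝ (Fin n))).map (fun Γ => ∑ j, t j • Γ j)) :=
    Measure.isProbabilityMeasure_map hm.aemeasurable
  refine Measure.ext_of_charFun ?_
  ext s
  rw [charFun_apply, integral_map hm.aemeasurable (by fun_prop)]
  have h1 : ∀ Γ : Fin k → EuclideanSpace ℝ (Fin n),
      Complex.exp (⟪∑ j, t j • Γ j, s⟫ * Complex.I) =
        ∏ j, Complex.exp (⟪Γ j, t j • s⟫ * Complex.I) := by
    intro Γ
    rw [← Complex.exp_sum, ← Finset.sum_mul, sum_inner]
    simp [inner_smul_left, inner_smul_right]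
  simp_rw [h1]
  rw [integral_fintype_prod_eq_prod (f := fun j (x : EuclideanSpace ℝ (Fin n)) =>
    Complex.exp (⟪x, t j • s⟫ * Complex.I))]
  simp_rw [← charFun_apply, charFun_stdGaussian]
  rw [← Complex.exp_sum]
  congr 1
  have h2 : ∑ j, t j ^ 2 = 1 := by
    rw [← EuclideanSpace.real_norm_sq_eq, ht, one_pow]
  have h3 : ∀ j, (‖t j • s‖ : ℂ) ^ 2 = (t j : ℂ) ^ 2 * (‖s‖ : ℂ) ^ 2 := fun j => by
    rw [norm_smul]; norm_cast; rw [mul_pow, Real.norm_eq_abs, sq_abs]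
  simp_rw [neg_div, h3, mul_div_assoc, Finset.sum_neg_distrib, ← Finset.sum_mul]
  rw [show ∑ j, (t j : ℂ) ^ 2 = 1 by exact_mod_cast h2, one_mul]

lemma card_le_of_separated_unit_sphere {k : ℕ} {ε : ℝ} (hε : 0 < ε)
    (T : Finset (EuclideanSpace ℝ (Fin k))) (hT : ∀ c ∈ T, ‖c‖ = 1)
    (h : ∀ c ∈ T, ∀ d ∈ T, c ≠ d → ε < ‖c - d‖) : (T.card : ℝ) ≤ (1 + 2 / ε) ^ k := by
  set A := ⋃ c ∈ T, Metric.ball (c : EuclideanSpace ℝ (Fin k)) (ε / 2) with hA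
  have D : Set.Pairwise (T : Set (EuclideanSpace ℝ (Fin k)))
      (Function.onFun Disjoint fun c => Metric.ball c (ε / 2)) := by
    intro c hc d hd hcd
    apply Metric.ball_disjoint_ball
    rw [dist_eq_norm]
    linarith [h c hc d hd hcd]
  have A_subset : A ⊆ Metric.ball 0 (1 + ε / 2) := by
    refine Set.iUnion₂_subset fun x hx => ?_
    apply Metric.ball_subset_ball'
    rw [dist_zero_right, hT x hx]; linarith
  have h1 := measure_mono (μ := volume) A_subset
  rw [hA, measure_biUnion_finset D fun c _ => measurableSet_ball] at h1
  simp only [Measure.addHaar_ball_of_pos volume _ (by positivity : 0 < ε / 2),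
    Measure.addHaar_ball_of_pos volume _ (by positivity : 0 < 1 + ε / 2)] at h1
  simp only [Finset.sum_const, nsmul_eq_mul, ← mul_assoc, finrank_euclideanSpace,
    Fintype.card_fin] at h1
  rw [ENNReal.mul_le_mul_iff_left (Metric.measure_ball_pos _ _ zero_lt_one).ne'
    measure_ball_lt_top.ne] at h1
  have h2 := ENNReal.toReal_le_of_le_ofReal (by positivity) h1
  rw [ENNReal.toReal_mul, ENNReal.toReal_natCast, ENNReal.toReal_ofReal (by positivity)] at h2
  rw [show 1 + 2 / ε = (1 + ε / 2) / (ε / 2) by field_simp; ring, div_pow,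
    le_div_iff₀ (by positivity)]
  exact h2

lemma exists_net_unit_sphere (k : ℕ) {ε : ℝ} (hε : 0 < ε) :
    ∃ T : Finset (EuclideanSpace ℝ (Fin k)), (T.card : ℝ) ≤ (1 + 2 / ε) ^ k ∧
      (∀ c ∈ T, ‖c‖ = 1) ∧ ∀ t : EuclideanSpace ℝ (Fin k), ‖t‖ = 1 → ∃ c ∈ T, ‖t - c‖ ≤ ε := by
  classical
  set P : ℕ → Prop := fun m => ∃ T : Finset (EuclideanSpace ℝ (Fin k)), T.card = m ∧
    (∀ c ∈ T, ‖c‖ = 1) ∧ ∀ c ∈ T, ∀ d ∈ T, c ≠ d → ε < ‖c - d‖ with hP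
  have hb : ∀ m, P m → m ≤ ⌊(1 + 2 / ε) ^ k⌋₊ := by
    rintro _ ⟨T, rfl, h1, h2⟩
    exact Nat.le_floor (card_le_of_separated_unit_sphere hε T h1 h2)
  have h0 : P 0 := ⟨∅, by simp, by simp, by simp⟩
  obtain ⟨T, hTc, hT1, hT2⟩ := Nat.findGreatest_spec (P := P) (Nat.zero_le ⌊(1 + 2 / ε) ^ k⌋₊) h0
  refine ⟨T, card_le_of_separated_unit_sphere hε T hT1 hT2, hT1, fun t ht => ?_⟩
  by_contra! hcon
  have htT : t ∉ T := fun hmem => by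
    have := hcon t hmem
    rw [sub_self, norm_zero] at this
    linarith
  have hP1 : P (T.card + 1) := by
    refine ⟨insert t T, Finset.card_insert_of_notMem htT, ?_, ?_⟩
    · intro c hc
      rcases Finset.mem_insert.mp hc with rfl | hc
      exacts [ht, hT1 c hc]
    · intro c hc d hd hcd
      rcases Finset.mem_insert.mp hc with rfl | hc' <;>
        rcases Finset.mem_insert.mp hd with rfl | hd'
      · exact absurd rfl hcd
      · exact hcon d hd'
      · rw [norm_sub_rev]; exact hcon c hc'
      · exact hT2 c hc' d hd' hcd
  have h3 := Nat.le_findGreatest (hb _ hP1) hP1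
  omega

lemma lintegral_exp_sq_gaussianReal_le :
    ∫⁻ z, ENNReal.ofReal (exp (z ^ 2 / 4)) ∂gaussianReal 0 1 ≤ 2 := by
  rw [gaussianReal_of_var_ne_zero _ one_ne_zero,
    lintegral_withDensity_eq_lintegral_mul _ (measurable_gaussianPDF 0 1) (by fun_prop)]
  have h : ∀ z, (gaussianPDF 0 1 * fun z => ENNReal.ofReal (exp (z ^ 2 / 4))) z =
      ENNReal.ofReal (√2) * gaussianPDF 0 2 z := by
    intro z
    simp only [Pi.mul_apply, gaussianPDF]
    rw [← ENNReal.ofReal_mul (gaussianPDFReal_nonneg 0 1 z), ← ENNReal.ofReal_mul (by positivity)]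
    congr 1
    simp only [gaussianPDFReal_def]
    rw [mul_assoc, ← Real.exp_add, ← mul_assoc]
    have e1 : √2 * (√(2 * π * (2 : NNReal)))⁻¹ = (√(2 * π * (1 : NNReal)))⁻¹ := by
      rw [Real.sqrt_mul (by positivity) ((2 : NNReal) : ℝ)]
      push_cast
      have : √2 ≠ 0 := by positivity
      have : √(2 * π) ≠ 0 := by positivity
      rw [mul_one]
      field_simp
    rw [e1]
    congr 2
    push_cast; ring
  rw [lintegral_congr h, lintegral_const_mul _ (measurable_gaussianPDF 0 2),
    lintegral_gaussianPDF_eq_one _ two_ne_zero, mul_one, ← ENNReal.ofReal_ofNat]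
  apply ENNReal.ofReal_le_ofReal
  rw [Real.sqrt_le_left (by norm_num)]; norm_num

lemma lintegral_pow_two_mul_gaussianReal_le {k : ℕ} (hk : 1 ≤ k) :
    ∫⁻ z, ‖z‖ₑ ^ (2 * k) ∂gaussianReal 0 1 ≤ ENNReal.ofReal ((3 * √k) ^ (2 * k)) := by
  have hk0 : (0 : ℝ) < k := by exact_mod_cast hk
  have h : ∀ z : ℝ, ‖z‖ₑ ^ (2 * k) ≤ ENNReal.ofReal ((4 * k) ^ k) *
      ENNReal.ofReal (exp (z ^ 2 / 4)) := by
    intro z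
    rw [← ofReal_norm, ← ENNReal.ofReal_pow (norm_nonneg _), ← ENNReal.ofReal_mul (by positivity)]
    apply ENNReal.ofReal_le_ofReal
    rw [pow_mul, Real.norm_eq_abs, sq_abs]
    have h1 : z ^ 2 ≤ 4 * k * exp (z ^ 2 / (4 * k)) := by
      have := Real.add_one_le_exp (z ^ 2 / (4 * k))
      calc z ^ 2 = 4 * k * (z ^ 2 / (4 * k)) := by field_simp
        _ ≤ _ := by gcongr; linarith
    calc (z ^ 2) ^ k ≤ (4 * k * exp (z ^ 2 / (4 * k))) ^ k := by gcongr
      _ = _ := by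
        rw [mul_pow, ← Real.exp_nat_mul]
        congr 2; field_simp
  refine (lintegral_mono h).trans ?_
  rw [lintegral_const_mul _ (by fun_prop)]
  refine (mul_le_mul_right lintegral_exp_sq_gaussianReal_le _).trans ?_
  rw [← ENNReal.ofReal_ofNat, ← ENNReal.ofReal_mul (by positivity)]
  apply ENNReal.ofReal_le_ofReal
  rw [pow_mul, mul_pow 3, Real.sq_sqrt hk0.le, mul_pow, mul_pow _ (k : ℝ)]
  have h1 : (4 : ℝ) ^ k * 2 ≤ (3 ^ 2) ^ k := by
    rw [show ((3 : ℝ) ^ 2) = 4 * (9 / 4) by norm_num, mul_pow]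
    gcongr
    calc (2 : ℝ) ≤ (9 / 4) ^ 1 := by norm_num
      _ ≤ _ := pow_le_pow_right₀ (by norm_num) hk
  calc (4 : ℝ) ^ k * k ^ k * 2 = 4 ^ k * 2 * k ^ k := by ring
    _ ≤ _ := by gcongr

lemma le_lintegral_pow_gaussianReal {k : ℕ} (hk : 1 ≤ k) :
    ENNReal.ofReal ((exp (-3) * √k) ^ k) ≤ ∫⁻ z, ‖z‖ₑ ^ k ∂gaussianReal 0 1 := by
  have hk1 : (1 : ℝ) ≤ k := by exact_mod_cast hk
  have hs2 : √(k : ℝ) ^ 2 = k := Real.sq_sqrt (by positivity)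
  have hs0 : 0 ≤ √(k : ℝ) := Real.sqrt_nonneg _
  have h1 : ENNReal.ofReal (exp (-3) ^ k) ≤ gaussianReal 0 1 (Set.Icc (√k) (√k + 1)) := by
    rw [gaussianReal_apply 0 one_ne_zero]
    calc ENNReal.ofReal (exp (-3) ^ k) = ∫⁻ _ in Set.Icc (√(k : ℝ)) (√k + 1),
          ENNReal.ofReal (exp (-3) ^ k) := by simp
      _ ≤ _ := by
        refine setLIntegral_mono' measurableSet_Icc fun z hz => ?_
        apply ENNReal.ofReal_le_ofReal
        simp only [gaussianPDFReal_def, sub_zero]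
        have h2 : exp (-1) ≤ (√(2 * π * (1 : NNReal)))⁻¹ := by
          rw [Real.exp_neg]
          have : √(2 * π * (1 : NNReal)) ≤ exp 1 := by
            rw [Real.sqrt_le_left (exp_pos _).le]
            have := Real.exp_one_gt_d9
            have := Real.pi_lt_d2
            push_cast
            nlinarith
          have h0 : 0 < √(2 * π * (1 : NNReal)) := by
            apply Real.sqrt_pos.mpr; push_cast; positivity
          gcongr
        have h3 : exp (-(k + 1)) ≤ exp (-z ^ 2 / (2 * (1 : NNReal))) := by
          rw [Real.exp_le_exp]
          push_cast
          obtain ⟨hz1, hz2⟩ := hz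
          have : z ^ 2 ≤ (√k + 1) ^ 2 := by gcongr; linarith
          nlinarith [sq_nonneg (√(k : ℝ) - 1)]
        calc exp (-3) ^ k ≤ exp (-1) * exp (-(k + 1)) := by
              rw [← Real.exp_nat_mul, ← Real.exp_add, Real.exp_le_exp]; linarith
          _ ≤ _ := by gcongr
  rw [mul_pow, mul_comm, ENNReal.ofReal_mul (by positivity)]
  calc ENNReal.ofReal (√k ^ k) * ENNReal.ofReal (exp (-3) ^ k)
      ≤ ENNReal.ofReal (√k ^ k) * gaussianReal 0 1 (Set.Icc (√k) (√k + 1)) := by gcongr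
    _ = ∫⁻ z in Set.Icc (√(k : ℝ)) (√k + 1), ENNReal.ofReal (√k ^ k) ∂gaussianReal 0 1 := by
        rw [setLIntegral_const]
    _ ≤ ∫⁻ z in Set.Icc (√(k : ℝ)) (√k + 1), ‖z‖ₑ ^ k ∂gaussianReal 0 1 := by
        refine setLIntegral_mono' measurableSet_Icc fun z hz => ?_
        rw [← ofReal_norm, ← ENNReal.ofReal_pow (norm_nonneg _)]
        apply ENNReal.ofReal_le_ofReal
        gcongr
        exact hz.1.trans (le_abs_self z)
    _ ≤ _ := setLIntegral_le_lintegral _ _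

lemma lintegral_inner_pow_stdGaussian {n : ℕ} (x : EuclideanSpace ℝ (Fin n)) (j : ℕ) :
    ∫⁻ G, ‖⟪G, x⟫‖ₑ ^ j ∂stdGaussian (EuclideanSpace ℝ (Fin n)) =
      ‖x‖ₑ ^ j * ∫⁻ z, ‖z‖ₑ ^ j ∂gaussianReal 0 1 := by
  have h1 : ∫⁻ G, ‖⟪G, x⟫‖ₑ ^ j ∂stdGaussian (EuclideanSpace ℝ (Fin n)) =
      ∫⁻ z, ‖z‖ₑ ^ j ∂(stdGaussian (EuclideanSpace ℝ (Fin n))).map (fun z => ⟪x, z⟫) := by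
    rw [lintegral_map (by fun_prop) (by fun_prop)]
    simp_rw [real_inner_comm]
  have h2 : gaussianReal 0 (‖x‖₊ ^ 2) = (gaussianReal 0 1).map (‖x‖ * ·) := by
    rw [gaussianReal_map_const_mul, mul_zero, mul_one]
    congr 1
  rw [h1, map_inner_stdGaussian, h2, lintegral_map (by fun_prop) (by fun_prop),
    ← lintegral_const_mul _ (by fun_prop)]
  refine lintegral_congr fun z => ?_
  rw [enorm_mul, mul_pow, enorm_norm]

lemma lintegral_sq_gaussianReal : ∫⁻ z, ‖z‖ₑ ^ 2 ∂gaussianReal 0 1 = 1 := by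
  have h1 := variance_fun_id_gaussianReal (μ := 0) (v := 1)
  rw [variance, evariance] at h1
  simp only [integral_id_gaussianReal, sub_zero] at h1
  rw [← ENNReal.ofReal_toReal (a := ∫⁻ z, ‖z‖ₑ ^ 2 ∂gaussianReal 0 1), h1]
  · simp
  · intro h; rw [h] at h1; simp at h1

/-- The `L^k(ν)`-norm of the linear functional `⟪y, ·⟫`. -/
def lpInner {n : ℕ} (ν : Measure (EuclideanSpace ℝ (Fin n))) (k : ℕ)
    (y : EuclideanSpace ℝ (Fin n)) : ℝ≥0∞ :=
  eLpNorm (fun x => ⟪y, x⟫) k ν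

section lpInner

variable {n : ℕ} {ν : Measure (EuclideanSpace ℝ (Fin n))} {k : ℕ}

lemma lpInner_pow (hk : 1 ≤ k) (y : EuclideanSpace ℝ (Fin n)) :
    lpInner ν k y ^ k = ∫⁻ x, ‖⟪y, x⟫‖ₑ ^ k ∂ν := by
  have hk0 : (k : ℝ) ≠ 0 := by positivity
  rw [lpInner, eLpNorm_eq_lintegral_rpow_enorm_toReal (by positivity) (by simp)]
  simp only [ENNReal.toReal_natCast, ENNReal.rpow_natCast]
  rw [← ENNReal.rpow_natCast, ← ENNReal.rpow_mul, one_div_mul_cancel hk0, ENNReal.rpow_one]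

lemma lpInner_add_le (hk : 1 ≤ k) (y z : EuclideanSpace ℝ (Fin n)) :
    lpInner ν k (y + z) ≤ lpInner ν k y + lpInner ν k z := by
  have h : (fun x => ⟪y + z, x⟫) = (fun x => ⟪y, x⟫) + fun x => ⟪z, x⟫ := by
    ext x; simp [inner_add_left]
  rw [lpInner, h]
  exact eLpNorm_add_le (by fun_prop) (by fun_prop) (by exact_mod_cast hk)

lemma lpInner_smul (c : ℝ) (y : EuclideanSpace ℝ (Fin n)) :
    lpInner ν k (c • y) = ‖c‖ₑ * lpInner ν k y := by
  have h : (fun x => ⟪c • y, x⟫) = c • fun x => ⟪y, x⟫ := by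
    ext x; simp [inner_smul_left]
  rw [lpInner, h, eLpNorm_const_smul]; rfl

lemma measurable_lpInner [SFinite ν] (hk : 1 ≤ k) : Measurable (lpInner ν k) := by
  have h : lpInner ν k = fun y => (∫⁻ x, ‖⟪y, x⟫‖ₑ ^ k ∂ν) ^ (1 / (k : ℝ)) := by
    ext y
    rw [lpInner, eLpNorm_eq_lintegral_rpow_enorm_toReal (by positivity) (by simp)]
    simp
  rw [h]
  refine Measurable.pow_const ?_ _
  exact Measurable.lintegral_prod_right' (f := fun p : EuclideanSpace ℝ (Fin n) × _ =>
    ‖⟪p.1, p.2⟫‖ₑ ^ k) (by fun_prop)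

end lpInner

lemma lintegral_sq_le_lintegral {α : Type*} [MeasurableSpace α] {μ : Measure α}
    [IsProbabilityMeasure μ] {f : α → ℝ≥0∞} (hf : AEMeasurable f μ) :
    (∫⁻ x, f x ∂μ) ^ 2 ≤ ∫⁻ x, f x ^ 2 ∂μ := by
  have h := ENNReal.lintegral_mul_le_Lp_mul_Lq μ Real.HolderConjugate.two_two hf
    (aemeasurable_const (b := (1 : ℝ≥0∞)))
  simp only [Pi.mul_apply, mul_one, ENNReal.one_rpow, lintegral_const, measure_univ] at h
  calc (∫⁻ x, f x ∂μ) ^ 2 ≤ ((∫⁻ x, f x ^ (2 : ℝ) ∂μ) ^ (1 / 2 : ℝ)) ^ 2 := by gcongr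
    _ = _ := by
      rw [← ENNReal.rpow_natCast, ← ENNReal.rpow_mul]
      norm_num

lemma exists_forall_exp_neg_le {c η : ℝ} (hc : 0 < c) (hη : 0 < η) :
    ∃ C : ℝ, 1 ≤ C ∧ exp (-(c * C ^ 2)) ≤ η := by
  refine ⟨max 1 (|log η| / c), le_max_left _ _, ?_⟩
  set C := max 1 (|log η| / c) with hC
  have h1 : 1 ≤ C := le_max_left _ _
  have h2 : |log η| / c ≤ C := le_max_right _ _
  rw [div_le_iff₀ hc] at h2
  calc exp (-(c * C ^ 2)) ≤ exp (log η) := by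
        rw [Real.exp_le_exp]
        have := neg_abs_le (log η)
        nlinarith [mul_pos hc (by linarith : 0 < C)]
    _ = η := Real.exp_log hη

set_option maxHeartbeats 1000000 in
lemma LogConcaveMeasure.exists_gaussian_lpInner :
    ∃ c K : ℝ, 0 < c ∧ 1 ≤ K ∧ ∀ η : ℝ, 0 < η → ∃ C : ℝ, 1 ≤ C ∧
      ∀ {n : ℕ} {ν : Measure (EuclideanSpace ℝ (Fin n))} [IsProbabilityMeasure ν],
      LogConcaveMeasure ν → ∀ {k : ℕ} {R S : ℝ}, 1 ≤ k → 0 < R → 0 < S →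
      ∫⁻ x, ‖x‖ₑ ^ k ∂ν = ENNReal.ofReal (R ^ k) →
      (∀ y, lpInner ν k y ≤ ENNReal.ofReal S * ‖y‖ₑ) → C * S ≤ R →
      stdGaussian (EuclideanSpace ℝ (Fin n)) {G | lpInner ν k G ≤ ENNReal.ofReal (c * √k * R)} ≤
        ENNReal.ofReal (η ^ k) ∧
      ∀ A : ℝ, 0 < A → stdGaussian (EuclideanSpace ℝ (Fin n))
        {G | ENNReal.ofReal (A * √k * R) ≤ lpInner ν k G} ≤ ENNReal.ofReal ((K / A) ^ (2 * k)) := by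
  obtain ⟨K, hK1, hK⟩ := LogConcaveMeasure.exists_moment_le
  refine ⟨exp (-3) / 4, 6 * K, by positivity, by linarith, fun η hη => ?_⟩
  set c := exp (-3) / 4 with hc
  have hc0 : 0 < c := by positivity
  set δ := 1 / (4 * (6 * K * exp 3) ^ 2) with hδ
  have hδ0 : 0 < δ := by positivity
  obtain ⟨C, hC1, hC⟩ := exists_forall_exp_neg_le (c := c ^ 2 / 4) (η := δ * η) (by positivity)
    (by positivity)
  refine ⟨C, hC1, ?_⟩
  intro n ν _ hν k R S hk hR hS hmom hweak hRS
  have hk0 : (0 : ℝ) < k := by exact_mod_cast hk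
  have hk1 : (1 : ℝ) ≤ k := by exact_mod_cast hk
  have hsk : 0 < √(k : ℝ) := Real.sqrt_pos.mpr hk0
  set γ := stdGaussian (EuclideanSpace ℝ (Fin n)) with hγ
  have hNm := measurable_lpInner (ν := ν) hk
  have hinnm : Measurable (Function.uncurry fun (G x : EuclideanSpace ℝ (Fin n)) => ‖⟪G, x⟫‖ₑ) := by
    unfold Function.uncurry; fun_prop
  have hswap : ∀ j, ∫⁻ G, ∫⁻ x, ‖⟪G, x⟫‖ₑ ^ j ∂ν ∂γ =
      (∫⁻ x, ‖x‖ₑ ^ j ∂ν) * ∫⁻ z, ‖z‖ₑ ^ j ∂gaussianReal 0 1 := by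
    intro j
    rw [lintegral_lintegral_swap (hinnm.pow_const j).aemeasurable]
    simp_rw [hγ, lintegral_inner_pow_stdGaussian]
    rw [lintegral_mul_const _ (by fun_prop)]
  have hW1 : ENNReal.ofReal ((exp (-3) * √k * R) ^ k) ≤ ∫⁻ G, lpInner ν k G ^ k ∂γ := by
    simp_rw [lpInner_pow hk]
    rw [hswap, hmom, mul_comm (exp (-3) * √k), mul_pow R, ENNReal.ofReal_mul (by positivity)]
    gcongr
    exact le_lintegral_pow_gaussianReal hk
  have hmom2 : ∫⁻ x, ‖x‖ₑ ^ (2 * k) ∂ν ≤ ENNReal.ofReal ((2 * K * R) ^ (2 * k)) := by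
    have h1 := hK hν (p := k) (q := (2 * k : ℕ)) (M := R) hk1 (by push_cast; linarith) hR (by
      simp only [ENNReal.rpow_natCast, Real.rpow_natCast]; exact hmom.le)
    simp only [ENNReal.rpow_natCast, Real.rpow_natCast] at h1
    have e : K * (((2 * k : ℕ) : ℝ) / k) * R = 2 * K * R := by
      push_cast; field_simp
    rwa [e] at h1
  have hW2 : ∫⁻ G, (lpInner ν k G ^ k) ^ 2 ∂γ ≤
      ENNReal.ofReal ((6 * K * (√k * R)) ^ (2 * k)) := by
    calc ∫⁻ G, (lpInner ν k G ^ k) ^ 2 ∂γ ≤ ∫⁻ G, ∫⁻ x, ‖⟪G, x⟫‖ₑ ^ (2 * k) ∂ν ∂γ := by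
          refine lintegral_mono fun G => ?_
          rw [lpInner_pow hk]
          refine (lintegral_sq_le_lintegral (by fun_prop)).trans (le_of_eq ?_)
          simp_rw [← pow_mul, mul_comm k 2]
      _ = (∫⁻ x, ‖x‖ₑ ^ (2 * k) ∂ν) * ∫⁻ z, ‖z‖ₑ ^ (2 * k) ∂gaussianReal 0 1 := hswap _
      _ ≤ ENNReal.ofReal ((2 * K * R) ^ (2 * k)) * ENNReal.ofReal ((3 * √k) ^ (2 * k)) := by
          gcongr
          exact lintegral_pow_two_mul_gaussianReal_le hk
      _ = _ := by
          rw [← ENNReal.ofReal_mul (by positivity), ← mul_pow]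
          ring_nf
  refine ⟨?_, ?_⟩
  · have hpz := paley_zygmund (μ := γ) (hNm.pow_const k) (w := (exp (-3) * √k * R) ^ k)
      (K := ((6 * K * exp 3) ^ 2) ^ k) (by positivity) (by positivity) hW1 (by
        refine hW2.trans (ENNReal.ofReal_le_ofReal (le_of_eq ?_))
        rw [← pow_mul (6 * K * exp 3), ← pow_mul, mul_comm k 2, ← mul_pow]
        congr 1
        have : exp 3 * exp (-3) = 1 := by rw [← Real.exp_add]; simp
        linear_combination (-6 * K * √k * R) * this)
    set a := c * √k * R with ha
    have ha0 : 0 < a := by positivity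
    have hA : ENNReal.ofReal (δ ^ k) ≤ γ {G | ENNReal.ofReal (2 * a) ≤ lpInner ν k G} := by
      refine le_trans ?_ (hpz.trans (measure_mono ?_))
      · apply ENNReal.ofReal_le_ofReal
        rw [hδ, div_pow, one_pow, mul_pow]
        gcongr
        calc (4 : ℝ) = 4 ^ 1 := by norm_num
          _ ≤ 4 ^ k := pow_le_pow_right₀ (by norm_num) hk
      · intro G hG
        simp only [Set.mem_ofPred_eq] at hG ⊢
        have h1 : ENNReal.ofReal (2 * a) ^ k ≤ lpInner ν k G ^ k := by
          refine le_trans ?_ hG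
          rw [← ENNReal.ofReal_pow (by positivity)]
          apply ENNReal.ofReal_le_ofReal
          rw [show 2 * a = exp (-3) * √k * R / 2 by rw [ha, hc]; ring, div_pow]
          gcongr
          calc (2 : ℝ) = 2 ^ 1 := by norm_num
            _ ≤ 2 ^ k := pow_le_pow_right₀ (by norm_num) hk
        exact (ENNReal.pow_le_pow_left_iff (by omega)).mp h1
    have hconc := stdGaussian_mul_le_of_dist (n := n) (ρ := a / S)
      (measurableSet_le measurable_const hNm : MeasurableSet
        {G | ENNReal.ofReal (2 * a) ≤ lpInner ν k G})
      (measurableSet_le hNm measurable_const : MeasurableSet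
        {G | lpInner ν k G ≤ ENNReal.ofReal a}) (by positivity) (by
      intro x hx y hy
      simp only [Set.mem_ofPred_eq] at hx hy
      have h1 : ENNReal.ofReal (2 * a) ≤ ENNReal.ofReal a + ENNReal.ofReal S * ‖x - y‖ₑ := by
        refine hx.trans ?_
        calc lpInner ν k x = lpInner ν k (y + (x - y)) := by congr 1; abel
          _ ≤ lpInner ν k y + lpInner ν k (x - y) := lpInner_add_le hk _ _
          _ ≤ _ := add_le_add hy (hweak _)
      rw [← ofReal_norm, ← ENNReal.ofReal_mul hS.le, ← ENNReal.ofReal_add ha0.le (by positivity),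
        ENNReal.ofReal_le_ofReal_iff (by positivity)] at h1
      rw [div_le_iff₀ hS]
      linarith)
    have h2 : ENNReal.ofReal (δ ^ k) * γ {G | lpInner ν k G ≤ ENNReal.ofReal a} ≤
        ENNReal.ofReal (δ ^ k) * ENNReal.ofReal (η ^ k) := by
      refine (mul_le_mul_left hA _).trans (hconc.trans ?_)
      rw [← ENNReal.ofReal_mul (by positivity), ← mul_pow]
      apply ENNReal.ofReal_le_ofReal
      calc exp (-((a / S) ^ 2 / 4)) ≤ exp (-(c ^ 2 / 4 * C ^ 2)) ^ k := by
            rw [← Real.exp_nat_mul, Real.exp_le_exp]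
            have h3 : C ≤ R / S := by rwa [le_div_iff₀ hS]
            have h4 : (a / S) ^ 2 = c ^ 2 * k * (R / S) ^ 2 := by
              rw [ha, div_pow, div_pow, mul_pow, mul_pow, Real.sq_sqrt hk0.le]; ring
            have h5 : C ^ 2 ≤ (R / S) ^ 2 := by gcongr
            rw [h4]
            have : c ^ 2 * k * C ^ 2 ≤ c ^ 2 * k * (R / S) ^ 2 := by gcongr
            linarith
        _ ≤ _ := by gcongr
    exact (ENNReal.mul_le_mul_iff_right (by
      simp only [ne_eq, ENNReal.ofReal_eq_zero, not_le]; positivity) (by simp)).mp h2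
  · intro A hA0
    have h1 := mul_meas_ge_le_lintegral (μ := γ) ((hNm.pow_const k).pow_const 2)
      (ENNReal.ofReal ((A * √k * R) ^ (2 * k)))
    have hsub : {G | ENNReal.ofReal (A * √k * R) ≤ lpInner ν k G} ⊆
        {G | ENNReal.ofReal ((A * √k * R) ^ (2 * k)) ≤ (lpInner ν k G ^ k) ^ 2} := by
      intro G hG
      simp only [Set.mem_ofPred_eq] at hG ⊢
      rw [ENNReal.ofReal_pow (by positivity), ← pow_mul, mul_comm k 2]
      gcongr
    have h2 : ENNReal.ofReal ((A * √k * R) ^ (2 * k)) *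
        γ {G | ENNReal.ofReal (A * √k * R) ≤ lpInner ν k G} ≤
        ENNReal.ofReal ((A * √k * R) ^ (2 * k)) * ENNReal.ofReal ((6 * K / A) ^ (2 * k)) := by
      refine (mul_le_mul_right (measure_mono hsub) _).trans (h1.trans (hW2.trans (le_of_eq ?_)))
      rw [← ENNReal.ofReal_mul (by positivity), ← mul_pow]
      congr 2
      field_simp
    exact (ENNReal.mul_le_mul_iff_right (by
      simp only [ne_eq, ENNReal.ofReal_eq_zero, not_le]; positivity) (by simp)).mp h2

/-- A seminorm on `ℝᵏ` bounded by `a` on a `1/2`-net of the sphere is bounded by `2 * a` on it. -/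
lemma le_of_forall_net_le {k : ℕ} {N : EuclideanSpace ℝ (Fin k) → ℝ≥0∞} {a B : ℝ≥0∞}
    (hadd : ∀ s t, N (s + t) ≤ N s + N t) (hsmul : ∀ (c : ℝ) t, N (c • t) = ‖c‖ₑ * N t)
    (hB : B ≠ ∞) (hNB : ∀ t, ‖t‖ = 1 → N t ≤ B) {T : Finset (EuclideanSpace ℝ (Fin k))}
    (hT : ∀ t : EuclideanSpace ℝ (Fin k), ‖t‖ = 1 → ∃ c ∈ T, ‖t - c‖ ≤ 1 / 2)
    (ha : ∀ c ∈ T, N c ≤ a) (t : EuclideanSpace ℝ (Fin k)) : N t ≤ 2 * a * ‖t‖ₑ := by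
  set s : ℝ≥0∞ := ⨆ t : {t : EuclideanSpace ℝ (Fin k) // ‖t‖ = 1}, N t.1 with hs
  have hsB : s ≤ B := iSup_le fun t => hNB t.1 t.2
  have hs_top : s ≠ ∞ := (hsB.trans_lt hB.lt_top).ne
  have hNs : ∀ t, N t ≤ s * ‖t‖ₑ := by
    intro t
    rcases eq_or_ne t 0 with rfl | ht
    · have := hsmul 0 0
      simp at this
      simp [this]
    · have h0 : ‖t‖ ≠ 0 := norm_ne_zero_iff.mpr ht
      have h1 : t = ‖t‖ • (‖t‖⁻¹ • t) := by rw [smul_smul, mul_inv_cancel₀ h0, one_smul]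
      have h2 : ‖‖t‖⁻¹ • t‖ = 1 := by
        rw [norm_smul, norm_inv, norm_norm, inv_mul_cancel₀ h0]
      calc N t = ‖t‖ₑ * N (‖t‖⁻¹ • t) := by
            conv_lhs => rw [h1, hsmul, enorm_norm]
        _ ≤ ‖t‖ₑ * s := by
            gcongr
            exact le_iSup (fun t : {t : EuclideanSpace ℝ (Fin k) // ‖t‖ = 1} => N t.1) ⟨_, h2⟩
        _ = _ := mul_comm _ _
  have hsa : s ≤ 2 * a := by
    have h1 : s ≤ a + s * ENNReal.ofReal (1 / 2) := by
      refine iSup_le fun t => ?_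
      obtain ⟨c, hcT, hc⟩ := hT t.1 t.2
      calc N t.1 = N (c + (t.1 - c)) := by congr 1; abel
        _ ≤ N c + N (t.1 - c) := hadd _ _
        _ ≤ a + s * ENNReal.ofReal (1 / 2) := by
            refine add_le_add (ha c hcT) ((hNs _).trans ?_)
            gcongr
            rw [← ofReal_norm]
            exact ENNReal.ofReal_le_ofReal hc
    rcases eq_or_ne a ∞ with rfl | ha'
    · simp
    lift s to NNReal using hs_top with s'
    lift a to NNReal using ha'
    rw [show ENNReal.ofReal (1 / 2) = ((1 / 2 : NNReal) : ℝ≥0∞) by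
      rw [ENNReal.ofReal, Real.toNNReal_div (by norm_num)]; simp] at h1
    norm_cast at h1 ⊢
    rw [← NNReal.coe_le_coe] at h1 ⊢
    push_cast at h1 ⊢
    linarith
  exact (hNs t).trans (by gcongr)

lemma pi_stdGaussian_exists_mem_le {k n : ℕ} {T : Finset (EuclideanSpace ℝ (Fin k))}
    (hT : ∀ c ∈ T, ‖c‖ = 1) {E : Set (EuclideanSpace ℝ (Fin n))} (hE : MeasurableSet E)
    {δ : ℝ≥0∞} (h : stdGaussian (EuclideanSpace ℝ (Fin n)) E ≤ δ) :
    (Measure.pi fun _ : Fin k => stdGaussian (EuclideanSpace ℝ (Fin n)))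
      {Γ | ∃ c ∈ T, ∑ j, c j • Γ j ∈ E} ≤ T.card * δ := by
  have h1 : {Γ : Fin k → EuclideanSpace ℝ (Fin n) | ∃ c ∈ T, ∑ j, c j • Γ j ∈ E} =
      ⋃ c ∈ T, (fun Γ => ∑ j, c j • Γ j) ⁻¹' E := by
    ext Γ; simp
  rw [h1, ← nsmul_eq_mul]
  refine (measure_biUnion_finset_le _ _).trans (Finset.sum_le_card_nsmul _ _ _ fun c hc => ?_)
  have h2 := map_sum_smul_pi_stdGaussian (n := n) (hT c hc)
  have hm : Measurable fun Γ : Fin k → EuclideanSpace ℝ (Fin n) => ∑ j, c j • Γ j := by fun_prop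
  rw [← Measure.map_apply hm hE, h2]
  exact h

lemma lintegral_pi_stdGaussian_sum_inner_sq {n k : ℕ} {ν : Measure (EuclideanSpace ℝ (Fin n))}
    [SFinite ν] :
    ∫⁻ Γ, ∫⁻ x, ∑ j, ‖⟪Γ j, x⟫‖ₑ ^ 2 ∂ν
      ∂(Measure.pi fun _ : Fin k => stdGaussian (EuclideanSpace ℝ (Fin n))) =
      k * ∫⁻ x, ‖x‖ₑ ^ 2 ∂ν := by
  rw [lintegral_lintegral_swap (by
    refine Measurable.aemeasurable ?_
    unfold Function.uncurry; fun_prop)]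
  rw [← lintegral_const_mul _ (by fun_prop)]
  refine lintegral_congr fun x => ?_
  rw [lintegral_finsetSum _ fun j _ => by fun_prop]
  have h : ∀ j : Fin k, ∫⁻ Γ, ‖⟪Γ j, x⟫‖ₑ ^ 2
      ∂(Measure.pi fun _ : Fin k => stdGaussian (EuclideanSpace ℝ (Fin n))) = ‖x‖ₑ ^ 2 := by
    intro j
    rw [(measurePreserving_eval (fun _ : Fin k => stdGaussian (EuclideanSpace ℝ (Fin n)))
      j).lintegral_comp (f := fun G => ‖⟪G, x⟫‖ₑ ^ 2) (by fun_prop),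
      lintegral_inner_pow_stdGaussian, lintegral_sq_gaussianReal, mul_one]
  simp [h]

lemma LogConcaveMeasure.exists_gaussian_matrix :
    ∃ c C : ℝ, 0 < c ∧ 1 ≤ C ∧
      ∀ {n : ℕ} {ν : Measure (EuclideanSpace ℝ (Fin n))} [IsProbabilityMeasure ν],
      LogConcaveMeasure ν → ∀ {k : ℕ} {R S r : ℝ}, 1 ≤ k → 0 < R → 0 < S → 0 < r →
      ∫⁻ x, ‖x‖ₑ ^ k ∂ν = ENNReal.ofReal (R ^ k) →
      (∀ y, lpInner ν k y ≤ ENNReal.ofReal S * ‖y‖ₑ) → C * S ≤ R →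
      ∫⁻ x, ‖x‖ₑ ^ 2 ∂ν ≤ ENNReal.ofReal (r ^ 2) →
      ∃ Γ : Fin k → EuclideanSpace ℝ (Fin n),
        (∀ t : EuclideanSpace ℝ (Fin k), ‖t‖ = 1 →
          ENNReal.ofReal (c * √k * R) ≤ lpInner ν k (∑ j, t j • Γ j)) ∧
        ∫⁻ x, ∑ j, ‖⟪Γ j, x⟫‖ₑ ^ 2 ∂ν ≤ ENNReal.ofReal (4 * k * r ^ 2) := by
  obtain ⟨c, K, hc, hK, h⟩ := LogConcaveMeasure.exists_gaussian_lpInner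
  set A := 8 * K with hA
  have hA0 : 0 < A := by positivity
  set ε := c / (4 * A) with hε
  have hε0 : 0 < ε := by positivity
  obtain ⟨C, hC1, hC⟩ := h (1 / (8 * (1 + 2 / ε))) (by positivity)
  refine ⟨c / 2, C, by positivity, hC1, ?_⟩
  intro n ν _ hν k R S r hk hR hS hr hmom hweak hRS h2
  have hk0 : (0 : ℝ) < k := by exact_mod_cast hk
  obtain ⟨hlow, hupp⟩ := hC hν hk hR hS hmom hweak hRS
  have hupp := hupp A hA0
  obtain ⟨T₁, hT₁card, hT₁, hT₁net⟩ := exists_net_unit_sphere k (ε := 1 / 2) (by norm_num)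
  obtain ⟨T₂, hT₂card, hT₂, hT₂net⟩ := exists_net_unit_sphere k hε0
  have hNm := measurable_lpInner (ν := ν) hk
  set μ := Measure.pi fun _ : Fin k => stdGaussian (EuclideanSpace ℝ (Fin n)) with hμ
  have hE₁ := pi_stdGaussian_exists_mem_le hT₁
    (measurableSet_le measurable_const hNm :
      MeasurableSet {G | ENNReal.ofReal (A * √k * R) ≤ lpInner ν k G}) hupp
  have hE₂ := pi_stdGaussian_exists_mem_le hT₂
    (measurableSet_le hNm measurable_const :
      MeasurableSet {G | lpInner ν k G ≤ ENNReal.ofReal (c * √k * R)}) hlow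
  have hE₃ : μ {Γ | ENNReal.ofReal (4 * k * r ^ 2) ≤ ∫⁻ x, ∑ j, ‖⟪Γ j, x⟫‖ₑ ^ 2 ∂ν} ≤
      ENNReal.ofReal (1 / 4) := by
    have hm : Measurable fun Γ : Fin k → EuclideanSpace ℝ (Fin n) =>
        ∫⁻ x, ∑ j, ‖⟪Γ j, x⟫‖ₑ ^ 2 ∂ν :=
      Measurable.lintegral_prod_right' (f := fun p : (Fin k → EuclideanSpace ℝ (Fin n)) ×
        EuclideanSpace ℝ (Fin n) => ∑ j, ‖⟪p.1 j, p.2⟫‖ₑ ^ 2) (by fun_prop)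
    have h3 := mul_meas_ge_le_lintegral (μ := μ) hm (ENNReal.ofReal (4 * k * r ^ 2))
    rw [hμ, lintegral_pi_stdGaussian_sum_inner_sq, ← hμ] at h3
    refine (ENNReal.mul_le_mul_iff_right (a := ENNReal.ofReal (4 * k * r ^ 2)) (by
      simp only [ne_eq, ENNReal.ofReal_eq_zero, not_le]; positivity) ENNReal.ofReal_ne_top).mp (h3.trans ?_)
    rw [← ENNReal.ofReal_mul (by positivity)]
    refine (mul_le_mul_right h2 _).trans (le_of_eq ?_)
    rw [← ENNReal.ofReal_natCast, ← ENNReal.ofReal_mul (by positivity)]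
    congr 1; ring
  have hpow : (1 / 8 : ℝ) ^ k ≤ 1 / 8 := by
    calc (1 / 8 : ℝ) ^ k ≤ (1 / 8) ^ 1 := pow_le_pow_of_le_one (by norm_num) (by norm_num) hk
      _ = _ := pow_one _
  have hE₁' := hE₁.trans (c := ENNReal.ofReal (1 / 8)) (by
    rw [← ENNReal.ofReal_natCast, ← ENNReal.ofReal_mul (by positivity)]
    apply ENNReal.ofReal_le_ofReal
    calc (T₁.card : ℝ) * (K / A) ^ (2 * k) ≤ (1 + 2 / (1 / 2)) ^ k * (K / A) ^ (2 * k) := by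
          gcongr
      _ = (5 / 64) ^ k := by
          rw [pow_mul, ← mul_pow, hA]; congr 1; field_simp; norm_num
      _ ≤ (1 / 8) ^ k := pow_le_pow_left₀ (by norm_num) (by norm_num) k
      _ ≤ _ := hpow)
  have hE₂' := hE₂.trans (c := ENNReal.ofReal (1 / 8)) (by
    rw [← ENNReal.ofReal_natCast, ← ENNReal.ofReal_mul (by positivity)]
    apply ENNReal.ofReal_le_ofReal
    calc (T₂.card : ℝ) * (1 / (8 * (1 + 2 / ε))) ^ k
        ≤ (1 + 2 / ε) ^ k * (1 / (8 * (1 + 2 / ε))) ^ k := by gcongr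
      _ = (1 / 8) ^ k := by rw [← mul_pow]; congr 1; field_simp
      _ ≤ _ := hpow)
  obtain ⟨Γ, hΓ⟩ : ∃ Γ, Γ ∉
      ({Γ | ∃ c ∈ T₁, ∑ j, c j • Γ j ∈ {G | ENNReal.ofReal (A * √k * R) ≤ lpInner ν k G}} ∪
      {Γ | ∃ t ∈ T₂, ∑ j, t j • Γ j ∈ {G | lpInner ν k G ≤ ENNReal.ofReal (c * √k * R)}}) ∪
      {Γ : Fin k → EuclideanSpace ℝ (Fin n) |
        ENNReal.ofReal (4 * k * r ^ 2) ≤ ∫⁻ x, ∑ j, ‖⟪Γ j, x⟫‖ₑ ^ 2 ∂ν} := by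
    by_contra! hall
    have h3 := (measure_union_le (μ := μ) _ _).trans (add_le_add
      ((measure_union_le _ _).trans (add_le_add hE₁' hE₂')) hE₃)
    rw [Set.eq_univ_of_forall hall, measure_univ, ← ENNReal.ofReal_add (by norm_num) (by norm_num),
      ← ENNReal.ofReal_add (by norm_num) (by norm_num), ENNReal.one_le_ofReal] at h3
    norm_num at h3
  simp only [Set.mem_union, Set.mem_ofPred_eq, not_or, not_exists, not_and, not_le] at hΓ
  obtain ⟨⟨h₁, h₂⟩, h₃⟩ := hΓ
  refine ⟨Γ, fun t ht => ?_, h₃.le⟩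
  set N : EuclideanSpace ℝ (Fin k) → ℝ≥0∞ := fun t => lpInner ν k (∑ j, t j • Γ j) with hN
  have hadd : ∀ s t, N (s + t) ≤ N s + N t := by
    intro s t
    simp only [hN, PiLp.add_apply, add_smul, Finset.sum_add_distrib]
    exact lpInner_add_le hk _ _
  have hsmul : ∀ (c : ℝ) t, N (c • t) = ‖c‖ₑ * N t := by
    intro c t
    simp only [hN, PiLp.smul_apply, smul_eq_mul, mul_smul, ← Finset.smul_sum]
    exact lpInner_smul c _
  have hB : ∀ t, ‖t‖ = 1 → N t ≤ ENNReal.ofReal S * ∑ j, ‖Γ j‖ₑ := by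
    intro t ht
    refine (hweak _).trans ?_
    gcongr
    refine (enorm_sum_le _ _).trans (Finset.sum_le_sum fun j _ => ?_)
    rw [enorm_smul]
    refine mul_le_of_le_one_left' ?_
    rw [← ofReal_norm, ENNReal.ofReal_le_one, ← ht]
    exact PiLp.norm_apply_le t j
  have hub := le_of_forall_net_le hadd hsmul (ENNReal.mul_ne_top (by simp) (by simp)) hB hT₁net
    (a := ENNReal.ofReal (A * √k * R)) fun c hc => (h₁ c hc).le
  obtain ⟨d, hd, htd⟩ := hT₂net t ht
  have h4 : N d ≤ N t + ENNReal.ofReal (c / 2 * √k * R) := by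
    calc N d = N (t + (d - t)) := by congr 1; abel
      _ ≤ N t + N (d - t) := hadd _ _
      _ ≤ _ := by
        gcongr
        refine (hub _).trans ?_
        have e2 : (2 : ℝ≥0∞) * ENNReal.ofReal (A * √k * R) = ENNReal.ofReal (2 * (A * √k * R)) := by
          rw [ENNReal.ofReal_mul (p := 2) (by norm_num)]; simp
        rw [← ofReal_norm, norm_sub_rev, e2, ← ENNReal.ofReal_mul (by positivity)]
        apply ENNReal.ofReal_le_ofReal
        calc 2 * (A * √k * R) * ‖t - d‖ ≤ 2 * (A * √k * R) * ε := by gcongr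
          _ = _ := by rw [hε]; field_simp; ring
  have h5 := (h₂ d hd).le.trans h4
  rw [show c * √k * R = c / 2 * √k * R + c / 2 * √k * R by ring,
    ENNReal.ofReal_add (by positivity) (by positivity)] at h5
  exact (ENNReal.add_le_add_iff_right (by simp)).mp h5

set_option maxHeartbeats 400000 in
/-- Paouris' inequality: the strong moment of order `k` of a log-concave vector is bounded by the
strong second moment plus the weak moment of order `k`. -/
lemma LogConcaveMeasure.exists_strong_moment_le :
    ∃ C : ℝ, 1 ≤ C ∧
      ∀ {n : ℕ} {ν : Measure (EuclideanSpace ℝ (Fin n))} [IsProbabilityMeasure ν],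
      LogConcaveMeasure ν → ∀ {k : ℕ} {r S : ℝ}, 2 ≤ k → 0 < r → 0 < S →
      ∫⁻ x, ‖x‖ₑ ^ 2 ∂ν ≤ ENNReal.ofReal (r ^ 2) →
      (∀ y, lpInner ν k y ≤ ENNReal.ofReal S * ‖y‖ₑ) →
      ∫⁻ x, ‖x‖ₑ ^ k ∂ν ≤ ENNReal.ofReal ((C * (r + S)) ^ k) := by
  obtain ⟨K, hK1, hK⟩ := LogConcaveMeasure.exists_moment_le
  obtain ⟨δ, hδ0, hδ1, hδ⟩ := LogConcaveMeasure.exists_lower_tail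
  obtain ⟨c, C, hc, hC1, hΓ⟩ := LogConcaveMeasure.exists_gaussian_matrix
  set D := 768 / δ ^ 2 * 3 * 2 / c with hD
  have hD0 : 0 < D := by positivity
  refine ⟨C + D, by linarith, ?_⟩
  intro n ν _ hν k r S hk hr hS h2 hweak
  have hk1 : 1 ≤ k := by omega
  have hk0 : (0 : ℝ) < k := by positivity
  have hfin : ∫⁻ x, ‖x‖ₑ ^ k ∂ν ≠ ∞ := by
    have h1 := hK hν (p := (2 : ℕ)) (q := k) (M := r) (by norm_num) (by exact_mod_cast hk) hr (by
      simp only [ENNReal.rpow_natCast, Real.rpow_natCast]; exact h2)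
    simp only [ENNReal.rpow_natCast] at h1
    exact (h1.trans_lt ENNReal.ofReal_lt_top).ne
  set R := (∫⁻ x, ‖x‖ₑ ^ k ∂ν).toReal ^ ((k : ℝ)⁻¹) with hRdef
  have hR0 : 0 ≤ R := by positivity
  have hRk : ∫⁻ x, ‖x‖ₑ ^ k ∂ν = ENNReal.ofReal (R ^ k) := by
    rw [hRdef, Real.rpow_inv_natCast_pow ENNReal.toReal_nonneg (by omega),
      ENNReal.ofReal_toReal hfin]
  rw [hRk]
  apply ENNReal.ofReal_le_ofReal
  gcongr
  rcases hR0.eq_or_lt with hR | hR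
  · rw [← hR]; positivity
  rcases lt_or_ge R (C * S) with hRS | hRS
  · nlinarith [mul_pos hD0 hr, mul_pos hD0 hS, mul_pos (by linarith : 0 < C) hr]
  suffices h : R ≤ D * r by nlinarith [mul_pos hD0 hS, mul_pos (by linarith : 0 < C) (add_pos hr hS)]
  obtain ⟨Γ, hlow, hΓ2⟩ := hΓ hν hk1 hR hS hr hRk hweak hRS h2
  let F : EuclideanSpace ℝ (Fin n) →ₗ[ℝ] EuclideanSpace ℝ (Fin k) :=
    { toFun := fun x => WithLp.toLp 2 fun j => ⟪Γ j, x⟫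
      map_add' := fun x y => by ext j; simp [inner_add_right]
      map_smul' := fun a x => by ext j; simp [inner_smul_right] }
  have hF : Measurable F := F.continuous_of_finiteDimensional.measurable
  have hinner : ∀ t x, ⟪t, F x⟫ = ⟪∑ j, t j • Γ j, x⟫ := by
    intro t x
    rw [sum_inner, PiLp.inner_apply]
    refine Finset.sum_congr rfl fun j _ => ?_
    simp [F, inner_smul_left, mul_comm]
  have hprob : IsProbabilityMeasure (ν.map F) := Measure.isProbabilityMeasure_map hF.aemeasurable
  have hνF := hν.map F hF
  have hF2 : ∫⁻ y, ‖y‖ₑ ^ 2 ∂ν.map F ≤ ENNReal.ofReal ((√(4 * k) * r) ^ 2) := by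
    rw [lintegral_map (by fun_prop) hF]
    rw [mul_pow, Real.sq_sqrt (by positivity)]
    refine (le_of_eq (lintegral_congr fun x => ?_)).trans hΓ2
    rw [← ofReal_norm, ← ENNReal.ofReal_pow (norm_nonneg _), EuclideanSpace.real_norm_sq_eq,
      ENNReal.ofReal_sum_of_nonneg (fun j _ => sq_nonneg _)]
    refine Finset.sum_congr rfl fun j _ => ?_
    rw [← ofReal_norm, ← ENNReal.ofReal_pow (norm_nonneg _), Real.norm_eq_abs, sq_abs]
    rfl
  set s := 3 * √k * r with hs
  have hs0 : 0 < s := by positivity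
  have hball : 1 / 2 ≤ ν.map F (Metric.closedBall 0 s) := by
    have h1 := measure_norm_ge_le (ν := ν.map F) (p := (2 : ℕ)) (M := √(4 * k) * r) (s := s)
      (by norm_num) (by positivity) hs0 (by
        simp only [ENNReal.rpow_natCast, Real.rpow_natCast]; exact hF2)
    rw [Real.rpow_natCast, hs, div_pow, mul_pow, mul_pow, mul_pow, Real.sq_sqrt (by positivity),
      Real.sq_sqrt (by positivity)] at h1
    have e : 4 * k * r ^ 2 / (3 ^ 2 * k * r ^ 2) = (4 / 9 : ℝ) := by field_simp; norm_num
    rw [e] at h1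
    have h3 : (Metric.closedBall (0 : EuclideanSpace ℝ (Fin k)) s)ᶜ ⊆ {x | 3 * √k * r ≤ ‖x‖} := by
      intro x hx
      simp only [Set.mem_compl_iff, mem_closedBall_zero_iff, not_le, Set.mem_ofPred_eq] at hx ⊢
      exact hx.le
    have h4 := (measure_mono h3).trans h1
    have h5 := measure_add_measure_compl (μ := ν.map F)
      (Metric.isClosed_closedBall (x := (0 : EuclideanSpace ℝ (Fin k))) (ε := s)).measurableSet
    rw [measure_univ] at h5
    by_contra! hlt
    have h6 : ν.map F (Metric.closedBall 0 s) + ν.map F (Metric.closedBall 0 s)ᶜ <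
        1 / 2 + 1 / 2 := ENNReal.add_lt_add hlt (h4.trans_lt (by
          rw [ENNReal.ofReal_lt_iff_lt_toReal (by norm_num) (by simp)]
          norm_num))
    rw [h5, ENNReal.add_halves] at h6
    exact lt_irrefl _ h6
  have hdir := hνF.le_of_forall_direction hk1 hs0 hδ0 hδ1 hball (b := c * √k * R / 2) (by
    intro t ht
    have hm : Measurable fun y : EuclideanSpace ℝ (Fin k) => ⟪t, y⟫ := by fun_prop
    have hprob' : IsProbabilityMeasure ((ν.map F).map fun y => ⟪t, y⟫) :=
      Measure.isProbabilityMeasure_map hm.aemeasurable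
    have hlc : LogConcaveMeasure ((ν.map F).map fun y => ⟪t, y⟫) :=
      hνF.map (innerSL ℝ t : EuclideanSpace ℝ (Fin k) →ₗ[ℝ] ℝ) hm
    have e : ∫⁻ z, ‖z‖ₑ ^ k ∂((ν.map F).map fun y => ⟪t, y⟫) =
        lpInner ν k (∑ j, t j • Γ j) ^ k := by
      rw [lintegral_map (by fun_prop) hm, lintegral_map (by fun_prop) hF, lpInner_pow hk1]
      simp_rw [hinner]
    have h1 := hδ hlc (k := k) (b := c * √k * R)
      (M := (S * ‖∑ j, t j • Γ j‖) ^ k) hk1 (by positivity) (by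
        rw [e, ENNReal.ofReal_pow (by positivity)]
        gcongr
        exact hlow t ht) (by
        rw [e, ENNReal.ofReal_pow (by positivity), ENNReal.ofReal_mul hS.le, ofReal_norm]
        gcongr
        exact hweak _)
    rw [Measure.map_apply hm (measurableSet_le measurable_const (by fun_prop))] at h1
    exact h1)
  have hsk : 0 < √(k : ℝ) := by positivity
  have h7 : c * R ≤ 768 / δ ^ 2 * 3 * 2 * r := by
    have : √k * (c * R) ≤ √k * (768 / δ ^ 2 * 3 * 2 * r) := by
      rw [hs] at hdir; linarith
    exact le_of_mul_le_mul_left this hsk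
  rw [hD, div_mul_eq_mul_div, le_div_iff₀ hc]
  linarith

/-- The orthogonal projection of `ℝⁿ` onto the coordinate subspace indexed by `J`. -/
def coordProj {n : ℕ} (J : Finset (Fin n)) :
    EuclideanSpace ℝ (Fin n) →ₗ[ℝ] EuclideanSpace ℝ (Fin n) where
  toFun x := WithLp.toLp 2 fun i => if i ∈ J then x i else 0
  map_add' x y := by ext i; by_cases h : i ∈ J <;> simp [h]
  map_smul' a x := by ext i; by_cases h : i ∈ J <;> simp [h]

section coordProj

variable {n : ℕ} (J : Finset (Fin n))

lemma coordProj_apply (x : EuclideanSpace ℝ (Fin n)) (i : Fin n) :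
    coordProj J x i = if i ∈ J then x i else 0 := rfl

lemma measurable_coordProj : Measurable (coordProj J) :=
  (coordProj J).continuous_of_finiteDimensional.measurable

lemma enorm_sq_coordProj (x : EuclideanSpace ℝ (Fin n)) :
    ‖coordProj J x‖ₑ ^ 2 = ∑ i ∈ J, ‖x i‖ₑ ^ 2 := by
  have h : ‖coordProj J x‖ ^ 2 = ∑ i ∈ J, x i ^ 2 := by
    rw [EuclideanSpace.real_norm_sq_eq]
    simp [coordProj_apply, Finset.sum_ite_mem]
  rw [← ofReal_norm, ← ENNReal.ofReal_pow (norm_nonneg _), h,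
    ENNReal.ofReal_sum_of_nonneg (fun j _ => sq_nonneg _)]
  refine Finset.sum_congr rfl fun j _ => ?_
  rw [← ofReal_norm, ← ENNReal.ofReal_pow (norm_nonneg _), Real.norm_eq_abs, sq_abs]

lemma inner_coordProj (x y : EuclideanSpace ℝ (Fin n)) :
    ⟪y, coordProj J x⟫ = ⟪coordProj J y, x⟫ := by
  simp only [PiLp.inner_apply]
  refine Finset.sum_congr rfl fun i _ => ?_
  by_cases h : i ∈ J <;> simp [coordProj_apply, h]

lemma norm_coordProj_le (x : EuclideanSpace ℝ (Fin n)) : ‖coordProj J x‖ ≤ ‖x‖ := by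
  rw [← sq_le_sq₀ (norm_nonneg _) (norm_nonneg _), EuclideanSpace.real_norm_sq_eq,
    EuclideanSpace.real_norm_sq_eq]
  refine Finset.sum_le_sum fun i _ => ?_
  rw [coordProj_apply]
  split_ifs
  · exact le_rfl
  · simpa using sq_nonneg (x i)

end coordProj

lemma lintegral_sq_le_of_lintegral_pow_le {α : Type*} [MeasurableSpace α] {ρ : Measure α}
    [IsProbabilityMeasure ρ] {V : Type*} [NormedAddCommGroup V] {f : α → V}
    (hf : AEStronglyMeasurable f ρ) {k : ℕ} (hk : 2 ≤ k) {M : ℝ} (hM : 0 ≤ M)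
    (h : ∫⁻ x, ‖f x‖ₑ ^ k ∂ρ ≤ ENNReal.ofReal (M ^ k)) :
    ∫⁻ x, ‖f x‖ₑ ^ 2 ∂ρ ≤ ENNReal.ofReal (M ^ 2) := by
  have e : ∀ j : ℕ, 1 ≤ j → eLpNorm f j ρ ^ j = ∫⁻ x, ‖f x‖ₑ ^ j ∂ρ := by
    intro j hj
    have hj0 : (j : ℝ) ≠ 0 := by positivity
    rw [eLpNorm_eq_lintegral_rpow_enorm_toReal (by positivity) (by simp)]
    simp only [ENNReal.toReal_natCast, ENNReal.rpow_natCast]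
    rw [← ENNReal.rpow_natCast, ← ENNReal.rpow_mul, one_div_mul_cancel hj0, ENNReal.rpow_one]
  rw [← e k (by omega), ENNReal.ofReal_pow hM, ENNReal.pow_le_pow_left_iff (by omega)] at h
  rw [← e 2 (by norm_num), ENNReal.ofReal_pow hM]
  gcongr
  exact (eLpNorm_le_eLpNorm_of_exponent_le (by exact_mod_cast hk) hf).trans h

lemma LogConcaveMeasure.exists_sum_sq_le :
    ∃ C : ℝ, 1 ≤ C ∧
      ∀ {n : ℕ} {ν ρ : Measure (EuclideanSpace ℝ (Fin n))} [IsProbabilityMeasure ν]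
      [IsProbabilityMeasure ρ], LogConcaveMeasure ν → ∀ {k : ℕ} {S : ℝ}, 2 ≤ k → 0 < S →
      (∀ i, ∫⁻ x, ‖x i‖ₑ ^ 2 ∂ν ≤ 1) → (∀ y, lpInner ν k y ≤ ENNReal.ofReal S * ‖y‖ₑ) →
      ρ ≤ ENNReal.ofReal (exp k) • ν → ∀ J : Finset (Fin n),
      ∑ i ∈ J, ∫⁻ x, ‖x i‖ₑ ^ 2 ∂ρ ≤ ENNReal.ofReal (C * (J.card + S ^ 2)) := by
  obtain ⟨C, hC1, hC⟩ := LogConcaveMeasure.exists_strong_moment_le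
  refine ⟨2 * (exp 1 * C) ^ 2, ?_, ?_⟩
  · have : 1 ≤ exp 1 * C := one_le_mul_of_one_le_of_one_le (by simp) hC1
    nlinarith
  intro n ν ρ _ _ hν k S hk hS hsq hweak hρ J
  rcases J.eq_empty_or_nonempty with rfl | hJ
  · simp
  have hJ0 : (0 : ℝ) < J.card := by exact_mod_cast hJ.card_pos
  have hm := measurable_coordProj J
  have hprob : IsProbabilityMeasure (ν.map (coordProj J)) :=
    Measure.isProbabilityMeasure_map hm.aemeasurable
  have h1 := hC (hν.map _ hm) (k := k) (r := √J.card) (S := S) hk (by positivity) hS (by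
    rw [lintegral_map (by fun_prop) hm, Real.sq_sqrt hJ0.le]
    simp_rw [enorm_sq_coordProj]
    rw [lintegral_finsetSum _ fun j _ => by fun_prop]
    refine (Finset.sum_le_card_nsmul _ _ 1 fun i _ => hsq i).trans (le_of_eq ?_)
    simp) (by
    intro y
    have e : lpInner (ν.map (coordProj J)) k y = lpInner ν k (coordProj J y) := by
      rw [lpInner, eLpNorm_map_measure (by fun_prop) hm.aemeasurable, lpInner]
      congr 1
      ext x
      exact inner_coordProj J x y
    rw [e]
    refine (hweak _).trans ?_
    gcongr
    rw [← ofReal_norm, ← ofReal_norm]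
    exact ENNReal.ofReal_le_ofReal (norm_coordProj_le J y))
  rw [lintegral_map (by fun_prop) hm] at h1
  have h2 := lintegral_sq_le_of_lintegral_pow_le (ρ := ρ) (f := coordProj J)
    hm.aestronglyMeasurable hk (M := exp 1 * (C * (√J.card + S))) (by positivity) (by
      calc ∫⁻ x, ‖coordProj J x‖ₑ ^ k ∂ρ
          ≤ ∫⁻ x, ‖coordProj J x‖ₑ ^ k ∂(ENNReal.ofReal (exp k) • ν) :=
            lintegral_mono' hρ le_rfl
        _ = ENNReal.ofReal (exp k) * ∫⁻ x, ‖coordProj J x‖ₑ ^ k ∂ν := by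
            rw [lintegral_smul_measure, smul_eq_mul]
        _ ≤ _ := (mul_le_mul_right h1 _).trans (le_of_eq (by
            rw [← ENNReal.ofReal_mul (by positivity), mul_pow (exp 1), ← Real.exp_nat_mul,
              mul_one])))
  rw [← lintegral_finsetSum _ fun j _ => by fun_prop]
  simp_rw [← enorm_sq_coordProj]
  refine h2.trans (ENNReal.ofReal_le_ofReal ?_)
  have h3 : (√J.card + S) ^ 2 ≤ 2 * (J.card + S ^ 2) := by
    have := Real.sq_sqrt hJ0.le
    nlinarith [sq_nonneg (√(J.card : ℝ) - S)]
  calc (exp 1 * (C * (√J.card + S))) ^ 2 = (exp 1 * C) ^ 2 * (√J.card + S) ^ 2 := by ring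
    _ ≤ (exp 1 * C) ^ 2 * (2 * (J.card + S ^ 2)) := by gcongr
    _ = _ := by ring

lemma lintegral_Ioi_mul_exp_le {w τ : ℝ} (hw : 0 < w) :
    ∫⁻ u in Set.Ioi τ, ENNReal.ofReal (exp (1 - u / w)) * ENNReal.ofReal (2 * u) ≤
      ENNReal.ofReal (8 * exp 1 * w ^ 2 * exp (-(τ / (2 * w)))) := by
  have hneg : -(1 / (2 * w)) < 0 := by
    rw [neg_lt_zero]; positivity
  have hInt : IntegrableOn (fun u => 4 * w * exp 1 * exp (-(1 / (2 * w)) * u)) (Set.Ioi τ) :=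
    (integrableOn_exp_mul_Ioi hneg τ).const_mul _
  calc ∫⁻ u in Set.Ioi τ, ENNReal.ofReal (exp (1 - u / w)) * ENNReal.ofReal (2 * u)
      ≤ ∫⁻ u in Set.Ioi τ, ENNReal.ofReal (4 * w * exp 1 * exp (-(1 / (2 * w)) * u)) := by
        refine setLIntegral_mono' measurableSet_Ioi fun u hu => ?_
        rw [← ENNReal.ofReal_mul (by positivity)]
        apply ENNReal.ofReal_le_ofReal
        have h1 : 2 * u ≤ 4 * w * exp (u / (2 * w)) := by
          have h2 := Real.add_one_le_exp (u / (2 * w))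
          have h3 : 2 * u = 4 * w * (u / (2 * w)) := by field_simp; ring
          rw [h3]
          gcongr
          linarith
        calc exp (1 - u / w) * (2 * u) ≤ exp (1 - u / w) * (4 * w * exp (u / (2 * w))) := by
              gcongr
          _ = 4 * w * (exp (1 - u / w) * exp (u / (2 * w))) := by ring
          _ = 4 * w * (exp 1 * exp (-(1 / (2 * w)) * u)) := by
              rw [← Real.exp_add, ← Real.exp_add]
              congr 2
              field_simp; ring
          _ = _ := by ring
    _ = ENNReal.ofReal (∫ u in Set.Ioi τ, 4 * w * exp 1 * exp (-(1 / (2 * w)) * u)) := by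
        rw [ofReal_integral_eq_lintegral_ofReal hInt (.of_forall fun u => by positivity)]
    _ = _ := by
        rw [integral_const_mul, integral_exp_mul_Ioi hneg]
        congr 1
        rw [show -(1 / (2 * w)) * τ = -(τ / (2 * w)) by ring]
        field_simp
        norm_num

lemma LogConcaveMeasure.lintegral_tail_coord_le {n : ℕ} {ρ : Measure (EuclideanSpace ℝ (Fin n))}
    [IsProbabilityMeasure ρ] (hρ : LogConcaveMeasure ρ) {i : Fin n} {v τ : ℝ} (hv : 0 < v)
    (h : ∫⁻ x, ‖x i‖ₑ ^ 2 ∂ρ ≤ ENNReal.ofReal (v ^ 2)) :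
    ∫⁻ u in Set.Ioi τ, ρ {x | u ≤ |x i|} ^ (1 / 2 : ℝ) * ENNReal.ofReal (2 * u) ≤
      ENNReal.ofReal (8 * exp 7 * v ^ 2 * exp (-(τ / (2 * (exp 3 * v))))) := by
  have hm : Measurable fun x : EuclideanSpace ℝ (Fin n) => x i := by fun_prop
  have hprob : IsProbabilityMeasure (ρ.map fun x => x i) :=
    Measure.isProbabilityMeasure_map hm.aemeasurable
  have hlc : LogConcaveMeasure (ρ.map fun x => x i) :=
    hρ.map (EuclideanSpace.proj i : EuclideanSpace ℝ (Fin n) →L[ℝ] ℝ).toLinearMap hm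
  have htail : ∀ u : ℝ, ρ {x | u ≤ |x i|} ^ (1 / 2 : ℝ) ≤
      ENNReal.ofReal (exp (1 - u / (exp 3 * v))) := by
    intro u
    have h1 := hlc.norm_tail_le (p := (2 : ℕ)) (M := v) (z := u / (exp 3 * v)) (by norm_num) hv (by
      simp only [ENNReal.rpow_natCast, Real.rpow_natCast]
      rw [lintegral_map (by fun_prop) hm]
      exact h)
    rw [div_mul_cancel₀ _ (by positivity),
      Measure.map_apply hm (measurableSet_le measurable_const (by fun_prop))] at h1
    calc ρ {x | u ≤ |x i|} ^ (1 / 2 : ℝ)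
        ≤ ENNReal.ofReal (exp (-(((2 : ℕ) : ℝ) * (u / (exp 3 * v) - 1)))) ^ (1 / 2 : ℝ) := by
          gcongr
          exact h1
      _ = _ := by
          rw [ENNReal.ofReal_rpow_of_pos (by positivity), ← Real.exp_mul]
          congr 2
          push_cast
          ring
  refine (lintegral_mono fun u => mul_le_mul_left (htail u) _).trans
    ((lintegral_Ioi_mul_exp_le (by positivity)).trans (le_of_eq ?_))
  congr 1
  have : exp 7 = exp 1 * exp 3 ^ 2 := by
    rw [← Real.exp_nat_mul, ← Real.exp_add]; norm_num
  rw [this]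
  ring

lemma LogConcaveMeasure.exists_sum_tail_le :
    ∃ T C : ℝ, 0 < T ∧ 1 ≤ C ∧
      ∀ {n : ℕ} {ν ρ : Measure (EuclideanSpace ℝ (Fin n))} [IsProbabilityMeasure ν]
      [IsProbabilityMeasure ρ], LogConcaveMeasure ν → LogConcaveMeasure ρ →
      ∀ {k m : ℕ} {S : ℝ}, 2 ≤ k → 1 ≤ m → m ≤ n → 0 < S →
      (∀ i, ∫⁻ x, ‖x i‖ₑ ^ 2 ∂ν ≤ 1) → (∀ y, lpInner ν k y ≤ ENNReal.ofReal S * ‖y‖ₑ) →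
      ρ ≤ ENNReal.ofReal (exp k) • ν →
      ∑ i, ∫⁻ u in Set.Ioi (T * log (exp 1 * n / m)),
        ρ {x | u ≤ |x i|} ^ (1 / 2 : ℝ) * ENNReal.ofReal (2 * u) ≤
        ENNReal.ofReal (C * (S ^ 2 + m)) := by
  obtain ⟨C, hC1, hC⟩ := LogConcaveMeasure.exists_sum_sq_le
  have hC0 : 0 < C := by linarith
  set β := √(2 * C) with hβ
  have hβ0 : 0 < β := by positivity
  have hβ2 : β ^ 2 = 2 * C := Real.sq_sqrt (by positivity)
  refine ⟨2 * (exp 3 * β), 16 * exp 7 * C, by positivity, ?_, ?_⟩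
  · have := Real.add_one_le_exp (7 : ℝ)
    nlinarith
  intro n ν ρ _ _ hν hρ k m S hk hm hmn hS hsq hweak hρν
  set L := log (exp 1 * n / m) with hL
  set τ := 2 * (exp 3 * β) * L with hτ
  have hm0 : (0 : ℝ) < m := by exact_mod_cast hm
  have hmn' : (m : ℝ) ≤ n := by exact_mod_cast hmn
  have hn0 : (0 : ℝ) < n := hm0.trans_le hmn'
  have hL0 : 0 ≤ L := by
    apply Real.log_nonneg
    rw [le_div_iff₀ hm0, one_mul]
    have := Real.add_one_le_exp (1 : ℝ)
    nlinarith
  set V : Fin n → ℝ≥0∞ := fun i => ∫⁻ x, ‖x i‖ₑ ^ 2 ∂ρ with hV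
  have hVtop : ∀ i, V i ≠ ∞ := by
    intro i
    have h1 := hC hν hk hS hsq hweak hρν {i}
    rw [Finset.sum_singleton] at h1
    exact (h1.trans_lt ENNReal.ofReal_lt_top).ne
  set J := Finset.univ.filter fun i => β ^ 2 ≤ (V i).toReal with hJ
  have hVJ : ∑ i ∈ J, (V i).toReal ≤ C * (J.card + S ^ 2) := by
    have h1 := hC hν hk hS hsq hweak hρν J
    have h2 := ENNReal.toReal_mono (by simp) h1
    rwa [ENNReal.toReal_sum fun i _ => hVtop i, ENNReal.toReal_ofReal (by positivity)] at h2
  have hJS : ∑ i ∈ J, (V i).toReal ≤ 2 * C * S ^ 2 := by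
    have h1 : (J.card : ℝ) * β ^ 2 ≤ ∑ i ∈ J, (V i).toReal := by
      rw [← nsmul_eq_mul]
      exact Finset.card_nsmul_le_sum _ _ _ fun i hi => (Finset.mem_filter.mp hi).2
    rw [hβ2] at h1
    have h2 : C * J.card ≤ C * S ^ 2 := by linarith
    linarith
  set I : Fin n → ℝ≥0∞ := fun i => ∫⁻ u in Set.Ioi τ,
    ρ {x | u ≤ |x i|} ^ (1 / 2 : ℝ) * ENNReal.ofReal (2 * u) with hI
  have hbig : ∀ i ∈ J, I i ≤ ENNReal.ofReal (8 * exp 7 * (V i).toReal) := by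
    intro i hi
    have hVi : β ^ 2 ≤ (V i).toReal := (Finset.mem_filter.mp hi).2
    have hVi0 : 0 < (V i).toReal := lt_of_lt_of_le (by positivity) hVi
    have h1 := hρ.lintegral_tail_coord_le (i := i) (v := √(V i).toReal) (τ := τ) (by positivity)
      (by rw [Real.sq_sqrt hVi0.le, ENNReal.ofReal_toReal (hVtop i)])
    refine h1.trans (ENNReal.ofReal_le_ofReal ?_)
    rw [Real.sq_sqrt hVi0.le]
    refine mul_le_of_le_one_right (by positivity) (Real.exp_le_one_iff.mpr ?_)
    rw [neg_nonpos]
    positivity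
  have hsmall : ∀ i ∈ Jᶜ, I i ≤ ENNReal.ofReal (8 * exp 7 * β ^ 2 * (m / n)) := by
    intro i hi
    have hVi : (V i).toReal < β ^ 2 := by
      simpa [hJ] using hi
    have h1 := hρ.lintegral_tail_coord_le (i := i) (v := β) (τ := τ) hβ0 (by
      change V i ≤ _
      rw [← ENNReal.ofReal_toReal (hVtop i)]
      exact ENNReal.ofReal_le_ofReal hVi.le)
    refine h1.trans (ENNReal.ofReal_le_ofReal ?_)
    gcongr
    rw [hτ, mul_div_cancel_left₀ _ (by positivity), Real.exp_neg, hL, Real.exp_log (by positivity),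
      inv_div]
    gcongr
    have := Real.add_one_le_exp (1 : ℝ)
    nlinarith
  calc ∑ i, I i = ∑ i ∈ J, I i + ∑ i ∈ Jᶜ, I i := (Finset.sum_add_sum_compl _ _).symm
    _ ≤ ∑ i ∈ J, ENNReal.ofReal (8 * exp 7 * (V i).toReal) +
        ∑ i ∈ Jᶜ, ENNReal.ofReal (8 * exp 7 * β ^ 2 * (m / n)) :=
      add_le_add (Finset.sum_le_sum hbig) (Finset.sum_le_sum hsmall)
    _ = ENNReal.ofReal (∑ i ∈ J, 8 * exp 7 * (V i).toReal +
        ∑ i ∈ Jᶜ, 8 * exp 7 * β ^ 2 * (m / n)) := by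
      rw [← ENNReal.ofReal_sum_of_nonneg fun i _ => by positivity,
        ← ENNReal.ofReal_sum_of_nonneg fun i _ => by positivity,
        ← ENNReal.ofReal_add (Finset.sum_nonneg fun i _ => by positivity)
          (Finset.sum_nonneg fun i _ => by positivity)]
    _ ≤ _ := by
      apply ENNReal.ofReal_le_ofReal
      have h1 : (Jᶜ.card : ℝ) ≤ n := by
        have := Finset.card_le_univ Jᶜ
        rw [Fintype.card_fin] at this
        exact_mod_cast this
      have h2 : ∑ i ∈ Jᶜ, 8 * exp 7 * β ^ 2 * (m / n) ≤ 16 * exp 7 * C * m := by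
        rw [Finset.sum_const, nsmul_eq_mul, hβ2]
        calc (Jᶜ.card : ℝ) * (8 * exp 7 * (2 * C) * (m / n))
            ≤ n * (8 * exp 7 * (2 * C) * (m / n)) := by gcongr
          _ = _ := by field_simp; norm_num
      have h3 : 8 * exp 7 * ∑ i ∈ J, (V i).toReal ≤ 8 * exp 7 * (2 * C * S ^ 2) := by gcongr
      rw [← Finset.mul_sum]
      linarith

/-- Moments of `H x = ∑ᵢ κ {u | x ∈ A i u}` on the sets of a class stable under intersection with
the sets `A i u`, from bounds on the conditional probabilities of the sets `A i u`. -/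
lemma setLIntegral_pow_sum_measure_le {α ι : Type*} [MeasurableSpace α] [Fintype ι] {ν : Measure α}
    [IsProbabilityMeasure ν] {κ : Measure ℝ} [SFinite κ] {A : ι → ℝ → Set α}
    (hA : ∀ i, MeasurableSet {p : α × ℝ | p.1 ∈ A i p.2}) {P : Set α → Prop}
    (hPm : ∀ B, P B → MeasurableSet B) (hPA : ∀ B i u, P B → P (B ∩ A i u)) {D : ℝ≥0∞}
    (hD : D ≠ ∞) {l : ℕ} (hl : 1 ≤ l)
    (h : ∀ B, P B → ν B ≠ 0 →
      ∑ i, ∫⁻ u, cond ν B (A i u) ^ (1 / 2 : ℝ) ∂κ ≤ D * ν B ^ (-(1 / (2 * l) : ℝ))) :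
    ∀ j ≤ l, ∀ B, P B → ∫⁻ x in B, (∑ i, κ {u | x ∈ A i u}) ^ j ∂ν ≤
      D ^ j * ν B ^ (1 - j / (2 * l) : ℝ) := by
  have hl0 : (0 : ℝ) < l := by exact_mod_cast hl
  have hκm : ∀ i, Measurable fun x => κ {u | x ∈ A i u} := fun i =>
    measurable_measure_prodMk_left (hA i)
  have hHm : Measurable fun x => ∑ i, κ {u | x ∈ A i u} := Finset.measurable_sum _ fun i _ => hκm i
  have hAim : ∀ i u, MeasurableSet (A i u) := fun i u => measurable_prodMk_right (hA i)
  intro j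
  induction j with
  | zero => intro _ B _; simp
  | succ j ih =>
    intro hj B hB
    have hBm := hPm B hB
    rcases eq_or_ne (ν B) 0 with h0 | h0
    · rw [Measure.restrict_eq_zero.mpr h0]; simp
    have hj' : (j : ℝ) + 1 ≤ l := by exact_mod_cast hj
    set a : ℝ := 1 - j / (2 * l) with ha
    have ha2 : 1 / 2 ≤ a := by
      have : (j : ℝ) / (2 * l) ≤ 1 / 2 := by
        rw [div_le_div_iff₀ (by positivity) (by norm_num)]; linarith
      linarith
    have hcond : ∀ i u, ν (B ∩ A i u) ^ a ≤ ν B ^ a * cond ν B (A i u) ^ (1 / 2 : ℝ) := by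
      intro i u
      have h1 : ν (B ∩ A i u) = ν B * cond ν B (A i u) := by
        rw [mul_comm, cond_mul_eq_inter hBm]
      rw [h1, ENNReal.mul_rpow_of_nonneg _ _ (by linarith)]
      have : IsProbabilityMeasure (cond ν B) := cond_isProbabilityMeasure h0
      exact mul_le_mul_right (ENNReal.rpow_le_rpow_of_exponent_ge prob_le_one ha2) _
    calc ∫⁻ x in B, (∑ i, κ {u | x ∈ A i u}) ^ (j + 1) ∂ν
        = ∑ i, ∫⁻ x in B, ∫⁻ u, (∑ i, κ {u | x ∈ A i u}) ^ j *
            (A i u).indicator 1 x ∂κ ∂ν := by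
          rw [← lintegral_finsetSum' _ fun i _ => ?_]
          · refine lintegral_congr fun x => ?_
            rw [pow_succ, Finset.mul_sum]
            refine Finset.sum_congr rfl fun i _ => ?_
            have hs : MeasurableSet {u | x ∈ A i u} := measurable_prodMk_left (hA i)
            rw [← lintegral_indicator_one hs, ← lintegral_const_mul _ (by measurability)]
            rfl
          · refine Measurable.aemeasurable ?_
            refine Measurable.lintegral_prod_right' (f := fun p : α × ℝ =>
              (∑ i, κ {u | p.1 ∈ A i u}) ^ j * (A i p.2).indicator 1 p.1) ?_
            exact ((hHm.comp measurable_fst).pow_const j).mul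
              (measurable_one.indicator (hA i))
      _ = ∑ i, ∫⁻ u, ∫⁻ x in B, (∑ i, κ {u | x ∈ A i u}) ^ j *
            (A i u).indicator 1 x ∂ν ∂κ := by
          refine Finset.sum_congr rfl fun i _ => ?_
          rw [lintegral_lintegral_swap]
          exact (((hHm.comp measurable_fst).pow_const j).mul
              (measurable_one.indicator (hA i))).aemeasurable
      _ = ∑ i, ∫⁻ u, ∫⁻ x in B ∩ A i u, (∑ i, κ {u | x ∈ A i u}) ^ j ∂ν ∂κ := by
          refine Finset.sum_congr rfl fun i _ => lintegral_congr fun u => ?_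
          rw [Set.inter_comm, ← Measure.restrict_restrict (hAim i u),
            ← lintegral_indicator (hAim i u)]
          refine lintegral_congr fun x => ?_
          by_cases hx : x ∈ A i u <;> simp [hx]
      _ ≤ ∑ i, ∫⁻ u, D ^ j * ν B ^ a * cond ν B (A i u) ^ (1 / 2 : ℝ) ∂κ := by
          refine Finset.sum_le_sum fun i _ => lintegral_mono fun u => ?_
          refine (ih (by omega) _ (hPA B i u hB)).trans ?_
          rw [mul_assoc]
          exact mul_le_mul_right (hcond i u) _
      _ = D ^ j * ν B ^ a * ∑ i, ∫⁻ u, cond ν B (A i u) ^ (1 / 2 : ℝ) ∂κ := by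
          rw [Finset.mul_sum]
          refine Finset.sum_congr rfl fun i _ => ?_
          rw [lintegral_const_mul' _ _ (ENNReal.mul_ne_top (ENNReal.pow_ne_top hD)
            (ENNReal.rpow_ne_top_of_nonneg (by linarith) (measure_ne_top _ _)))]
      _ ≤ D ^ j * ν B ^ a * (D * ν B ^ (-(1 / (2 * l) : ℝ))) := by
          gcongr
          exact h B hB h0
      _ = _ := by
          rw [mul_mul_mul_comm, ← pow_succ, ← ENNReal.rpow_add _ _ h0 (measure_ne_top _ _)]
          congr 2
          push_cast
          rw [ha]
          ring

lemma LogConcaveMeasure.exists_lpInner_le :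
    ∃ K : ℝ, 1 ≤ K ∧
      ∀ {n : ℕ} {ν : Measure (EuclideanSpace ℝ (Fin n))} [IsProbabilityMeasure ν],
      LogConcaveMeasure ν → ∀ {l k : ℕ} {S : ℝ}, 1 ≤ l → l ≤ k → 0 < S →
      (∀ y, lpInner ν l y ≤ ENNReal.ofReal S * ‖y‖ₑ) →
      ∀ y, lpInner ν k y ≤ ENNReal.ofReal (K * (k / l) * S) * ‖y‖ₑ := by
  obtain ⟨K, hK1, hK⟩ := LogConcaveMeasure.exists_moment_le
  refine ⟨K, hK1, ?_⟩
  intro n ν _ hν l k S hl hlk hS hweak y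
  rcases eq_or_ne y 0 with rfl | hy
  · simp [lpInner]
  have hk : 1 ≤ k := hl.trans hlk
  have hy0 : 0 < ‖y‖ := norm_pos_iff.mpr hy
  have hm : Measurable fun x : EuclideanSpace ℝ (Fin n) => ⟪y, x⟫ := by fun_prop
  have hprob : IsProbabilityMeasure (ν.map fun x => ⟪y, x⟫) :=
    Measure.isProbabilityMeasure_map hm.aemeasurable
  have hlc : LogConcaveMeasure (ν.map fun x => ⟪y, x⟫) :=
    hν.map (innerSL ℝ y : EuclideanSpace ℝ (Fin n) →ₗ[ℝ] ℝ) hm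
  have e : ∀ j : ℕ, 1 ≤ j → ∫⁻ z, ‖z‖ₑ ^ j ∂(ν.map fun x => ⟪y, x⟫) = lpInner ν j y ^ j := by
    intro j hj
    rw [lintegral_map (by fun_prop) hm, lpInner_pow hj]
  have h1 := hK hlc (p := l) (q := k) (M := S * ‖y‖) (by exact_mod_cast hl)
    (by exact_mod_cast hlk) (by positivity) (by
      simp only [ENNReal.rpow_natCast, Real.rpow_natCast]
      rw [e l hl, ENNReal.ofReal_pow (by positivity), ENNReal.ofReal_mul hS.le, ofReal_norm]
      gcongr
      exact hweak y)
  simp only [ENNReal.rpow_natCast, Real.rpow_natCast] at h1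
  rw [e k hk, ENNReal.ofReal_pow (by positivity), ENNReal.pow_le_pow_left_iff (by omega)] at h1
  rwa [← mul_assoc, ENNReal.ofReal_mul (by positivity), ofReal_norm] at h1

lemma cond_le_exp_smul {α : Type*} [MeasurableSpace α] {ν : Measure α} [IsProbabilityMeasure ν]
    {B : Set α} (hB : ν B ≠ 0) {k : ℝ} (hk : -log (ν B).toReal ≤ k) :
    ProbabilityTheory.cond ν B ≤ ENNReal.ofReal (exp k) • ν := by
  have hQ : 0 < (ν B).toReal := ENNReal.toReal_pos hB (measure_ne_top _ _)
  have h1 : (ν B)⁻¹ ≤ ENNReal.ofReal (exp k) := by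
    rw [← ENNReal.ofReal_toReal (measure_ne_top ν B), ← ENNReal.ofReal_inv_of_pos hQ]
    apply ENNReal.ofReal_le_ofReal
    rw [← Real.exp_log (inv_pos.mpr hQ), Real.exp_le_exp, Real.log_inv]
    exact hk
  refine Measure.le_intro fun s hs _ => ?_
  rw [ProbabilityTheory.cond, Measure.smul_apply, Measure.smul_apply, smul_eq_mul, smul_eq_mul]
  gcongr
  exact Measure.restrict_le_self

/-- The density `2 * u` on `(τ, ∞)`. -/
def tailMeasure (τ : ℝ) : Measure ℝ :=
  (volume.restrict (Set.Ioi τ)).withDensity fun u => ENNReal.ofReal (2 * u)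

instance (τ : ℝ) : SFinite (tailMeasure τ) := by unfold tailMeasure; infer_instance

/-- The half-spaces `{x | ±x i ≥ u}`. -/
def coordHalfSpace {n : ℕ} (p : Fin n × Bool) (u : ℝ) : Set (EuclideanSpace ℝ (Fin n)) :=
  {x | u ≤ (if p.2 then 1 else -1) * x p.1}

lemma coordHalfSpace_subset {n : ℕ} (p : Fin n × Bool) (u : ℝ) :
    coordHalfSpace p u ⊆ {x | u ≤ |x p.1|} := by
  intro x hx
  simp only [coordHalfSpace, Set.mem_ofPred_eq] at hx ⊢
  refine hx.trans ?_
  split_ifs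
  · simpa using le_abs_self _
  · simpa using neg_le_abs _

lemma convex_coordHalfSpace {n : ℕ} (p : Fin n × Bool) (u : ℝ) :
    Convex ℝ (coordHalfSpace p u) :=
  convex_halfSpace_ge ⟨fun x y => by simp [mul_add], fun c x => by simp⟩ u

lemma measurableSet_coordHalfSpace {n : ℕ} (p : Fin n × Bool) :
    MeasurableSet {q : EuclideanSpace ℝ (Fin n) × ℝ | q.1 ∈ coordHalfSpace p q.2} := by
  unfold coordHalfSpace
  simp only [Set.mem_ofPred_eq]
  exact measurableSet_le (by fun_prop) (by fun_prop)

lemma LogConcaveMeasure.exists_lintegral_excess_pow_le :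
    ∃ T C : ℝ, 0 < T ∧ 1 ≤ C ∧
      ∀ {n : ℕ} {ν : Measure (EuclideanSpace ℝ (Fin n))} [IsProbabilityMeasure ν],
      LogConcaveMeasure ν → ∀ {l m : ℕ} {S : ℝ}, 2 ≤ l → 1 ≤ m → m ≤ n → 0 < S →
      (∀ i, ∫⁻ x, ‖x i‖ₑ ^ 2 ∂ν ≤ 1) → (∀ y, lpInner ν l y ≤ ENNReal.ofReal S * ‖y‖ₑ) →
      ∫⁻ x, (∑ p, tailMeasure (T * log (exp 1 * n / m)) {u | x ∈ coordHalfSpace p u}) ^ l ∂ν ≤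
        ENNReal.ofReal ((C * (S ^ 2 + m)) ^ l) := by
  obtain ⟨T, C, hT, hC1, hC⟩ := LogConcaveMeasure.exists_sum_tail_le
  obtain ⟨K, hK1, hK⟩ := LogConcaveMeasure.exists_lpInner_le
  refine ⟨T, 2 * (C * (16 * K ^ 2)), hT, ?_, ?_⟩
  · nlinarith [one_le_mul_of_one_le_of_one_le hC1 (one_le_pow₀ hK1 (n := 2))]
  intro n ν _ hν l m S hl hm hmn hS hsq hweak
  set τ := T * log (exp 1 * n / m) with hτ
  set D := 2 * (C * (16 * K ^ 2)) * (S ^ 2 + m) with hD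
  have hD0 : 0 ≤ D := by positivity
  have hl0 : (0 : ℝ) < l := by positivity
  have h2l : (2 : ℝ) ≤ l := by exact_mod_cast hl
  have key := setLIntegral_pow_sum_measure_le (ν := ν) (κ := tailMeasure τ)
    (A := coordHalfSpace (n := n)) measurableSet_coordHalfSpace
    (P := fun B => Convex ℝ B ∧ MeasurableSet B) (fun B hB => hB.2)
    (fun B p u hB => ⟨hB.1.inter (convex_coordHalfSpace p u),
      hB.2.inter (measurable_prodMk_right (measurableSet_coordHalfSpace p))⟩)
    (D := ENNReal.ofReal D) ENNReal.ofReal_ne_top (l := l) (by omega) (by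
      intro B hB hB0
      set Q := (ν B).toReal with hQdef
      have hQ0 : 0 < Q := ENNReal.toReal_pos hB0 (measure_ne_top _ _)
      have hQ1 : Q ≤ 1 := by
        rw [hQdef]
        exact ENNReal.toReal_le_of_le_ofReal zero_le_one (by simpa using prob_le_one)
      set L := -log Q with hL
      have hL0 : 0 ≤ L := by rw [hL, neg_nonneg]; exact Real.log_nonpos hQ0.le hQ1
      set k := l + ⌈L⌉₊ with hk
      have hkL : (k : ℝ) ≤ 2 * l + L := by
        rw [hk]; push_cast
        have := Nat.ceil_lt_add_one hL0
        linarith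
      have hLk : L ≤ k := by
        rw [hk]; push_cast
        have := Nat.le_ceil L
        linarith
      have : IsProbabilityMeasure (ProbabilityTheory.cond ν B) := cond_isProbabilityMeasure hB0
      have h1 := hC hν (hν.cond hB.1 hB.2 hB0) (k := k) (m := m) (by omega) hm hmn
        (S := K * (k / l) * S) (by positivity) hsq (hK hν (by omega) (by omega) hS hweak)
        (cond_le_exp_smul hB0 hLk)
      have h2 : ∀ p : Fin n × Bool, ∫⁻ u, ProbabilityTheory.cond ν B (coordHalfSpace p u) ^ (1 / 2 : ℝ)
          ∂tailMeasure τ ≤ ∫⁻ u in Set.Ioi τ, ProbabilityTheory.cond ν B {x | u ≤ |x p.1|} ^ (1 / 2 : ℝ) *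
            ENNReal.ofReal (2 * u) := by
        intro p
        have hanti : Measurable fun u : ℝ => ProbabilityTheory.cond ν B {x | u ≤ |x p.1|} ^ (1 / 2 : ℝ) :=
          (Antitone.measurable fun s t hst => measure_mono fun x hx =>
            le_trans hst hx : Measurable fun u : ℝ => ProbabilityTheory.cond ν B {x | u ≤ |x p.1|}).pow_const _
        calc ∫⁻ u, ProbabilityTheory.cond ν B (coordHalfSpace p u) ^ (1 / 2 : ℝ) ∂tailMeasure τ
            ≤ ∫⁻ u, ProbabilityTheory.cond ν B {x | u ≤ |x p.1|} ^ (1 / 2 : ℝ) ∂tailMeasure τ := by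
              refine lintegral_mono fun u => ?_
              gcongr
              exact coordHalfSpace_subset p u
          _ = _ := by
              rw [tailMeasure, lintegral_withDensity_eq_lintegral_mul _ (by fun_prop) hanti]
              refine lintegral_congr fun u => ?_
              rw [Pi.mul_apply, mul_comm]
      refine (Finset.sum_le_sum fun p _ => h2 p).trans ?_
      rw [Fintype.sum_prod_type]
      simp only [Fintype.sum_bool, ← two_mul]
      rw [← Finset.mul_sum]
      refine (mul_le_mul_right h1 2).trans ?_
      rw [← ENNReal.ofReal_toReal (measure_ne_top ν B), ← hQdef,
        ENNReal.ofReal_rpow_of_pos hQ0, ← ENNReal.ofReal_mul hD0,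
        ← ENNReal.ofReal_ofNat 2, ← ENNReal.ofReal_mul (by norm_num)]
      apply ENNReal.ofReal_le_ofReal
      have hx : (k / l : ℝ) ≤ 2 + L / l := by
        rw [div_le_iff₀ hl0, add_mul, div_mul_cancel₀ _ hl0.ne']
        exact hkL
      have hQpow : Q ^ (-(1 / (2 * l) : ℝ)) = exp (L / l / 4) ^ 2 := by
        rw [Real.rpow_def_of_pos hQ0, ← Real.exp_nat_mul]
        congr 1
        rw [hL]; push_cast; field_simp; norm_num
      have hx2 : (k / l : ℝ) ≤ 4 * exp (L / l / 4) := by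
        have := Real.add_one_le_exp (L / l / 4)
        linarith
      have hexp1 : 1 ≤ exp (L / l / 4) := Real.one_le_exp (by positivity)
      rw [hQpow, hD]
      set E := exp (L / l / 4) with hE
      have h3 : (K * (k / l) * S) ^ 2 + m ≤ 16 * K ^ 2 * E ^ 2 * (S ^ 2 + m) := by
        have h4 : (K * (k / l) * S) ^ 2 ≤ (K * (4 * E) * S) ^ 2 := by gcongr
        have h5 : 1 ≤ 16 * K ^ 2 * E ^ 2 := by
          nlinarith [one_le_pow₀ hK1 (n := 2), one_le_pow₀ hexp1 (n := 2)]
        have h6 : (m : ℝ) ≤ 16 * K ^ 2 * E ^ 2 * m := le_mul_of_one_le_left (by positivity) h5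
        nlinarith
      calc 2 * (C * ((K * (k / l) * S) ^ 2 + m))
          ≤ 2 * (C * (16 * K ^ 2 * E ^ 2 * (S ^ 2 + m))) := by gcongr
        _ = _ := by ring) l le_rfl Set.univ ⟨convex_univ, MeasurableSet.univ⟩
  rw [Measure.restrict_univ, measure_univ, ENNReal.one_rpow, mul_one,
    ← ENNReal.ofReal_pow hD0] at key
  exact key

lemma ofReal_sq_le_add_tailMeasure {τ z : ℝ} (hτ : 0 ≤ τ) (hz : 0 ≤ z) :
    ENNReal.ofReal (z ^ 2) ≤ ENNReal.ofReal (τ ^ 2) + tailMeasure τ {u | u ≤ z} := by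
  rcases le_or_gt z τ with h | h
  · exact (ENNReal.ofReal_le_ofReal (by gcongr)).trans le_self_add
  have h1 : tailMeasure τ {u | u ≤ z} = ENNReal.ofReal (z ^ 2 - τ ^ 2) := by
    have hs : MeasurableSet {u : ℝ | u ≤ z} := measurableSet_Iic
    rw [tailMeasure, withDensity_apply _ hs, Measure.restrict_restrict hs,
      show {u : ℝ | u ≤ z} ∩ Set.Ioi τ = Set.Ioc τ z by ext u; simp [and_comm],
      ← ofReal_integral_eq_lintegral_ofReal, ← intervalIntegral.integral_of_le h.le]
    · rw [intervalIntegral.integral_const_mul, integral_id]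
      congr 1
      ring
    · exact (Continuous.integrableOn_Icc (by fun_prop)).mono_set Set.Ioc_subset_Icc_self
    · refine (ae_restrict_iff' measurableSet_Ioc).mpr (.of_forall fun u hu => ?_)
      have := hu.1
      simp only [Pi.zero_apply]
      linarith
  rw [h1, ← ENNReal.ofReal_add (by positivity) (by nlinarith)]
  apply ENNReal.ofReal_le_ofReal
  linarith

lemma ofReal_sum_sq_le_add_sum_tailMeasure {n : ℕ} {τ : ℝ} (hτ : 0 ≤ τ) (I : Finset (Fin n))
    (x : EuclideanSpace ℝ (Fin n)) :
    ENNReal.ofReal (∑ i ∈ I, x i ^ 2) ≤ ENNReal.ofReal (I.card * τ ^ 2) +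
      ∑ p, tailMeasure τ {u | x ∈ coordHalfSpace p u} := by
  have h1 : ∀ i, ENNReal.ofReal (x i ^ 2) ≤ ENNReal.ofReal (τ ^ 2) +
      ∑ b, tailMeasure τ {u | x ∈ coordHalfSpace (i, b) u} := by
    intro i
    rw [← sq_abs]
    refine (ofReal_sq_le_add_tailMeasure hτ (abs_nonneg _)).trans ?_
    gcongr
    rw [Fintype.sum_bool]
    rcases abs_choice (x i) with h | h <;> rw [h]
    · refine le_trans (le_of_eq ?_) le_self_add
      simp [coordHalfSpace]
    · refine le_trans (le_of_eq ?_) le_add_self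
      simp [coordHalfSpace]
  rw [ENNReal.ofReal_sum_of_nonneg fun i _ => sq_nonneg _, Fintype.sum_prod_type]
  refine (Finset.sum_le_sum fun i _ => h1 i).trans ?_
  rw [Finset.sum_add_distrib]
  refine add_le_add ?_ (Finset.sum_le_sum_of_subset (Finset.subset_univ I))
  rw [Finset.sum_const, nsmul_eq_mul, ENNReal.ofReal_mul (by positivity), ENNReal.ofReal_natCast]

/-- Tail bound for the largest coordinate projections in terms of a weak moment. -/
lemma LogConcaveMeasure.exists_measure_coord_le (S₀ : ℝ) (hS₀ : 0 < S₀) :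
    ∃ C : ℝ, 0 < C ∧
      ∀ {n : ℕ} {ν : Measure (EuclideanSpace ℝ (Fin n))} [IsProbabilityMeasure ν],
      LogConcaveMeasure ν → ∀ {l m : ℕ} {t : ℝ}, 2 ≤ l → 1 ≤ m → m ≤ n → 1 ≤ t →
      (∀ i, ∫⁻ x, ‖x i‖ₑ ^ 2 ∂ν ≤ 1) →
      (∀ y, lpInner ν l y ≤
        ENNReal.ofReal (S₀ * (t * √m * log (exp 1 * n / m))) * ‖y‖ₑ) →
      ν {x | ∃ I : Finset (Fin n), I.card = m ∧
        C * t * √m * log (exp 1 * n / m) ≤ √(∑ i ∈ I, x i ^ 2)} ≤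
        ENNReal.ofReal (exp (-l)) := by
  obtain ⟨T, C, hT, hC1, hC⟩ := LogConcaveMeasure.exists_lintegral_excess_pow_le
  have hC0 : 0 < C := by linarith
  refine ⟨√(T ^ 2 + exp 1 * (C * (S₀ ^ 2 + 1))), by positivity, ?_⟩
  intro n ν _ hν l m t hl hm hmn ht hsq hweak
  set L := log (exp 1 * n / m) with hL
  have hm0 : (0 : ℝ) < m := by exact_mod_cast hm
  have hmn' : (m : ℝ) ≤ n := by exact_mod_cast hmn
  have hn0 : (0 : ℝ) < n := hm0.trans_le hmn'
  have hL1 : 1 ≤ L := by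
    rw [hL, Real.le_log_iff_exp_le (by positivity), le_div_iff₀ hm0]
    gcongr
  set s := t * √m * L with hs
  have hs0 : 0 < s := by positivity
  have hs2 : s ^ 2 = t ^ 2 * m * L ^ 2 := by
    rw [hs, mul_pow, mul_pow, Real.sq_sqrt hm0.le]
  have ht2 : 1 ≤ t ^ 2 := one_le_pow₀ ht
  have hL2 : 1 ≤ L ^ 2 := one_le_pow₀ hL1
  have hms : (m : ℝ) ≤ s ^ 2 := by
    rw [hs2, mul_right_comm]
    exact le_mul_of_one_le_left hm0.le (one_le_mul_of_one_le_of_one_le ht2 hL2)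
  have hmLs : (m : ℝ) * L ^ 2 ≤ s ^ 2 := by
    rw [hs2, mul_assoc]
    exact le_mul_of_one_le_left (by positivity) ht2
  have key := hC hν hl hm hmn (S := S₀ * s) (by positivity) hsq hweak
  set τ := T * L with hτ
  set D := C * ((S₀ * s) ^ 2 + m) with hD
  have hD0 : 0 < D := by positivity
  set H : EuclideanSpace ℝ (Fin n) → ℝ≥0∞ := fun x =>
    ∑ p, tailMeasure τ {u | x ∈ coordHalfSpace p u} with hH
  have hHm : Measurable H := Finset.measurable_sum _ fun p _ =>
    measurable_measure_prodMk_left (measurableSet_coordHalfSpace p)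
  have hsub : {x : EuclideanSpace ℝ (Fin n) | ∃ I : Finset (Fin n), I.card = m ∧
      √(T ^ 2 + exp 1 * (C * (S₀ ^ 2 + 1))) * t * √m * L ≤ √(∑ i ∈ I, x i ^ 2)} ⊆
      {x | ENNReal.ofReal ((exp 1 * D) ^ l) ≤ H x ^ l} := by
    rintro x ⟨I, hI, hx⟩
    rw [Set.mem_ofPred_eq, ENNReal.ofReal_pow (by positivity)]
    gcongr
    have h1 := ofReal_sum_sq_le_add_sum_tailMeasure (τ := τ) (by positivity) I x
    rw [hI] at h1
    have h2 : m * τ ^ 2 + exp 1 * D ≤ ∑ i ∈ I, x i ^ 2 := by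
      rw [← Real.sq_sqrt (Finset.sum_nonneg fun i _ => sq_nonneg (x i) :
        0 ≤ ∑ i ∈ I, x i ^ 2)]
      refine le_trans ?_ (pow_le_pow_left₀ (by positivity) hx 2)
      have e : (√(T ^ 2 + exp 1 * (C * (S₀ ^ 2 + 1))) * t * √m * L) ^ 2 =
          (T ^ 2 + exp 1 * (C * (S₀ ^ 2 + 1))) * s ^ 2 := by
        rw [mul_assoc, mul_assoc, ← mul_assoc t, ← hs, mul_pow, Real.sq_sqrt (by positivity)]
      rw [e, hτ, hD]
      have h3 : T ^ 2 * (m * L ^ 2) ≤ T ^ 2 * s ^ 2 := by gcongr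
      have h4 : exp 1 * (C * ((S₀ * s) ^ 2 + m)) ≤ exp 1 * (C * ((S₀ * s) ^ 2 + s ^ 2)) := by
        gcongr
      nlinarith
    have h3 := (ENNReal.ofReal_le_ofReal h2).trans h1
    rw [ENNReal.ofReal_add (by positivity) (by positivity)] at h3
    exact (ENNReal.add_le_add_iff_left ENNReal.ofReal_ne_top).mp h3
  have h5 := (mul_meas_ge_le_lintegral (μ := ν) (hHm.pow_const l)
    (ENNReal.ofReal ((exp 1 * D) ^ l))).trans key
  have hexp : (exp 1 * D) ^ l * exp (-(l : ℝ)) = D ^ l := by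
    rw [mul_pow, mul_right_comm, ← Real.exp_nat_mul, ← Real.exp_add]
    simp
  refine (measure_mono hsub).trans ?_
  refine (ENNReal.mul_le_mul_iff_right (a := ENNReal.ofReal ((exp 1 * D) ^ l)) (by
    simp only [ne_eq, ENNReal.ofReal_eq_zero, not_le]; positivity)
    ENNReal.ofReal_ne_top).mp (h5.trans (le_of_eq ?_))
  rw [← ENNReal.ofReal_mul (by positivity), hexp]

lemma IsIsotropic.lintegral_enorm_sq_le {Ω : Type*} [MeasurableSpace Ω] {μ : Measure Ω} {n : ℕ}
    {X : Ω → EuclideanSpace ℝ (Fin n)} (h : IsIsotropic μ X) (i : Fin n) :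
    ∫⁻ ω, ‖X ω i‖ₑ ^ 2 ∂μ ≤ 1 := by
  have h1 : ∫ ω, X ω i * X ω i ∂μ = 1 := by simpa using h.2 i i
  have hInt : Integrable (fun ω => X ω i * X ω i) μ := by
    by_contra hc
    rw [integral_undef hc] at h1
    exact zero_ne_one h1
  have h2 := ofReal_integral_eq_lintegral_ofReal hInt (.of_forall fun ω => mul_self_nonneg _)
  rw [h1, ENNReal.ofReal_one] at h2
  rw [h2]
  refine lintegral_mono fun ω => le_of_eq ?_
  rw [← sq, ← sq_abs, ENNReal.ofReal_pow (abs_nonneg _), ← Real.norm_eq_abs, ofReal_norm]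

lemma LogConcaveMeasure.lintegral_norm_rpow_lt_top {n : ℕ}
    {ν : Measure (EuclideanSpace ℝ (Fin n))} [IsProbabilityMeasure ν] (hν : LogConcaveMeasure ν)
    (hsq : ∀ i, ∫⁻ x, ‖x i‖ₑ ^ 2 ∂ν ≤ 1) {p : ℝ} (hp : 1 ≤ p) :
    ∫⁻ x, ‖x‖ₑ ^ p ∂ν < ∞ := by
  obtain ⟨K, hK1, hK⟩ := LogConcaveMeasure.exists_moment_le
  have h2 : ∀ x : EuclideanSpace ℝ (Fin n), ‖x‖ₑ ≤ 1 + ∑ i, ‖x i‖ₑ ^ 2 := by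
    intro x
    have e : ∑ i, ‖x i‖ₑ ^ 2 = ‖x‖ₑ ^ 2 := by
      simp only [← ofReal_norm, ← ENNReal.ofReal_pow (norm_nonneg _)]
      rw [EuclideanSpace.norm_sq_eq, ENNReal.ofReal_sum_of_nonneg fun i _ => sq_nonneg _]
    rw [e]
    rcases le_total ‖x‖ₑ 1 with h | h
    · exact h.trans le_self_add
    · exact (le_self_pow₀ h two_ne_zero).trans le_add_self
  have h1 : ∫⁻ x, ‖x‖ₑ ^ (1 : ℝ) ∂ν ≤ ENNReal.ofReal ((1 + n : ℝ) ^ (1 : ℝ)) := by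
    simp only [ENNReal.rpow_one, Real.rpow_one]
    calc ∫⁻ x, ‖x‖ₑ ∂ν ≤ ∫⁻ x, (1 + ∑ i, ‖x i‖ₑ ^ 2) ∂ν := lintegral_mono h2
      _ = 1 + ∑ i, ∫⁻ x, ‖x i‖ₑ ^ 2 ∂ν := by
        rw [lintegral_add_left measurable_const, lintegral_finsetSum _ fun i _ => by fun_prop]
        simp
      _ ≤ 1 + ∑ i : Fin n, 1 := by gcongr with i; exact hsq i
      _ = ENNReal.ofReal (1 + n : ℝ) := by
        rw [ENNReal.ofReal_add zero_le_one (by positivity)]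
        simp
  exact (hK hν le_rfl hp (by positivity) h1).trans_lt ENNReal.ofReal_lt_top

lemma lintegral_inner_rpow_le_of_sigmaX_le {Ω : Type*} [MeasurableSpace Ω] {μ : Measure Ω}
    {n : ℕ} {X : Ω → EuclideanSpace ℝ (Fin n)} (hX : Measurable X) {p s : ℝ} (hp : 1 ≤ p)
    (hfin : ∫⁻ ω, ‖X ω‖ₑ ^ p ∂μ < ∞) (hs : sigmaX μ X p ≤ s)
    {u : EuclideanSpace ℝ (Fin n)} (hu : ‖u‖ = 1) :
    ∫⁻ ω, ‖⟪u, X ω⟫‖ₑ ^ p ∂μ ≤ ENNReal.ofReal (s ^ p) := by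
  have hp0 : 0 < p := by linarith
  have hn : Integrable (fun ω => ‖X ω‖ ^ p) μ := by
    refine ⟨(hX.norm.pow_const p).aestronglyMeasurable, ?_⟩
    refine lt_of_le_of_lt (lintegral_mono fun ω => le_of_eq ?_) hfin
    rw [Real.enorm_rpow_of_nonneg (norm_nonneg _) hp0.le, enorm_norm]
  have hle : ∀ v : EuclideanSpace ℝ (Fin n), ‖v‖ = 1 → ∀ ω, |⟪v, X ω⟫| ^ p ≤ ‖X ω‖ ^ p := by
    intro v hv ω
    gcongr
    simpa [hv] using abs_real_inner_le_norm v (X ω)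
  have hi : ∀ v : EuclideanSpace ℝ (Fin n), ‖v‖ = 1 →
      Integrable (fun ω => |⟪v, X ω⟫| ^ p) μ := by
    intro v hv
    refine hn.mono' ((Measurable.norm (by fun_prop : Measurable fun ω => ⟪v, X ω⟫)).pow_const
      p).aestronglyMeasurable (.of_forall fun ω => ?_)
    rw [Real.norm_of_nonneg (by positivity)]
    exact hle v hv ω
  have hbdd : BddAbove (Set.range fun v : {v : EuclideanSpace ℝ (Fin n) // ‖v‖ = 1} =>
      (∫ ω, |⟪v.1, X ω⟫| ^ p ∂μ) ^ (1 / p)) := by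
    refine ⟨(∫ ω, ‖X ω‖ ^ p ∂μ) ^ (1 / p), ?_⟩
    rintro _ ⟨v, rfl⟩
    refine Real.rpow_le_rpow (integral_nonneg fun ω => by positivity) ?_ (by positivity)
    exact integral_mono (hi v.1 v.2) hn (hle v.1 v.2)
  have h1 : (∫ ω, |⟪u, X ω⟫| ^ p ∂μ) ^ (1 / p) ≤ s := (le_ciSup hbdd ⟨u, hu⟩).trans hs
  have h0 : 0 ≤ ∫ ω, |⟪u, X ω⟫| ^ p ∂μ := integral_nonneg fun ω => by positivity
  have h2 : ∫ ω, |⟪u, X ω⟫| ^ p ∂μ ≤ s ^ p := by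
    have := Real.rpow_le_rpow (by positivity) h1 hp0.le
    rwa [← Real.rpow_mul h0, one_div_mul_cancel hp0.ne', Real.rpow_one] at this
  refine le_trans (le_of_eq ?_) (ENNReal.ofReal_le_ofReal h2)
  rw [ofReal_integral_eq_lintegral_ofReal (hi u hu) (.of_forall fun ω => by positivity)]
  refine lintegral_congr fun ω => ?_
  rw [← ENNReal.ofReal_rpow_of_nonneg (abs_nonneg _) hp0.le, ← Real.norm_eq_abs, ofReal_norm]

lemma LogConcaveMeasure.exists_lpInner_le_of_lintegral_rpow_le :
    ∃ S : ℝ, 0 < S ∧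
      ∀ {n : ℕ} {ν : Measure (EuclideanSpace ℝ (Fin n))} [IsProbabilityMeasure ν],
      LogConcaveMeasure ν → ∀ {p s : ℝ} {l : ℕ}, 1 ≤ p → p ≤ l → l ≤ 2 * p → 0 < s →
      (∀ u : EuclideanSpace ℝ (Fin n), ‖u‖ = 1 →
        ∫⁻ x, ‖⟪u, x⟫‖ₑ ^ p ∂ν ≤ ENNReal.ofReal (s ^ p)) →
      ∀ y, lpInner ν l y ≤ ENNReal.ofReal (S * s) * ‖y‖ₑ := by
  obtain ⟨K, hK1, hK⟩ := LogConcaveMeasure.exists_moment_le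
  refine ⟨K * 2, by positivity, ?_⟩
  intro n ν _ hν p s l hp hpl hl hs h y
  have hp0 : 0 < p := by linarith
  have hl1 : 1 ≤ l := by exact_mod_cast hp.trans hpl
  have hunit : ∀ u : EuclideanSpace ℝ (Fin n), ‖u‖ = 1 →
      lpInner ν l u ≤ ENNReal.ofReal (K * 2 * s) := by
    intro u hu
    have hm : Measurable fun x : EuclideanSpace ℝ (Fin n) => ⟪u, x⟫ := by fun_prop
    have hprob : IsProbabilityMeasure (ν.map fun x => ⟪u, x⟫) :=
      Measure.isProbabilityMeasure_map hm.aemeasurable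
    have hlc : LogConcaveMeasure (ν.map fun x => ⟪u, x⟫) :=
      hν.map (innerSL ℝ u : EuclideanSpace ℝ (Fin n) →ₗ[ℝ] ℝ) hm
    have h1 := hK hlc hp hpl hs (by rw [lintegral_map (by fun_prop) hm]; exact h u hu)
    simp only [ENNReal.rpow_natCast, Real.rpow_natCast] at h1
    rw [lintegral_map (by fun_prop) hm, ← lpInner_pow hl1, ENNReal.ofReal_pow (by positivity),
      ENNReal.pow_le_pow_left_iff (by omega)] at h1
    refine h1.trans (ENNReal.ofReal_le_ofReal ?_)
    gcongr
    rwa [div_le_iff₀ hp0]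
  rcases eq_or_ne y 0 with rfl | hy
  · simp [lpInner]
  have hy0 : ‖y‖ ≠ 0 := norm_ne_zero_iff.mpr hy
  have e : y = ‖y‖ • (‖y‖⁻¹ • y) := by rw [smul_smul, mul_inv_cancel₀ hy0, one_smul]
  have h2 := hunit (‖y‖⁻¹ • y) (by rw [norm_smul, norm_inv, norm_norm, inv_mul_cancel₀ hy0])
  calc lpInner ν l y = ‖y‖ₑ * lpInner ν l (‖y‖⁻¹ • y) := by
        conv_lhs => rw [e]
        rw [lpInner_smul, enorm_norm]
    _ ≤ ‖y‖ₑ * ENNReal.ofReal (K * 2 * s) := by gcongr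
    _ = _ := mul_comm _ _

lemma exists_finset_of_le_iSup_sqrt {n m : ℕ} (hmn : m ≤ n) {c : ℝ} (x : Fin n → ℝ)
    (h : c ≤ ⨆ I : {I : Finset (Fin n) // I.card = m}, √(∑ i ∈ I.1, x i ^ 2)) :
    ∃ I : Finset (Fin n), I.card = m ∧ c ≤ √(∑ i ∈ I, x i ^ 2) := by
  obtain ⟨J, -, hJ⟩ := Finset.exists_subset_card_eq
    (show m ≤ (Finset.univ : Finset (Fin n)).card by simpa)
  have : Nonempty {I : Finset (Fin n) // I.card = m} := ⟨⟨J, hJ⟩⟩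
  obtain ⟨I, hI⟩ := exists_eq_ciSup_of_finite
    (f := fun I : {I : Finset (Fin n) // I.card = m} => √(∑ i ∈ I.1, x i ^ 2))
  exact ⟨I.1, I.2, h.trans hI.ge⟩

lemma le_exp_neg_sSup {A : Set ℝ} {P : ℝ} (hP0 : 0 ≤ P) (hP1 : P ≤ 1)
    (h : ∀ p ∈ A, P ≤ exp (-p)) : P ≤ exp (-sSup A) := by
  rcases hP0.eq_or_lt with rfl | hP
  · positivity
  have h1 : sSup A ≤ -log P := by
    refine Real.sSup_le (fun p hp => ?_) (by linarith [Real.log_nonpos hP0 hP1])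
    linarith [(Real.log_le_iff_le_exp hP).mpr (h p hp)]
  rw [← Real.log_le_iff_le_exp hP]
  linarith

/-- There is a universal constant `C > 0` such that for every isotropic log-concave random
vector `X` in `ℝⁿ`, every `1 ≤ m ≤ n` and every `t ≥ 1`,
`P(max_{|I|=m} |P_I X| ≥ C·t·√m·log(en/m)) ≤ exp(−σ_X⁻¹(t·√m·log(en/m)))`. -/
theorem uniform_paouris_tail :
    ∃ C : ℝ, 0 < C ∧
      ∀ (Ω : Type) (_ : MeasurableSpace Ω) (μ : Measure Ω), IsProbabilityMeasure μ →
      ∀ (n : ℕ) (X : Ω → EuclideanSpace ℝ (Fin n)), Measurable X →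
      IsLogConcave μ X → IsIsotropic μ X →
      ∀ m : ℕ, 1 ≤ m → m ≤ n →
      ∀ t : ℝ, 1 ≤ t →
        (μ {ω | C * t * Real.sqrt m * Real.log (Real.exp 1 * n / m) ≤
            ⨆ I : {I : Finset (Fin n) // I.card = m},
              Real.sqrt (∑ i ∈ I.1, (X ω i) ^ 2)}).toReal ≤
          Real.exp (-(sigmaXInv μ X (t * Real.sqrt m * Real.log (Real.exp 1 * n / m)))) := by
  obtain ⟨S, hS, hweak⟩ := LogConcaveMeasure.exists_lpInner_le_of_lintegral_rpow_le
  obtain ⟨C, hC, htail⟩ := LogConcaveMeasure.exists_measure_coord_le S hS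
  refine ⟨C, hC, ?_⟩
  intro Ω _ μ _ n X hX hlc hiso m hm hmn t ht
  have hν : LogConcaveMeasure (μ.map X) := hlc.logConcaveMeasure_map hX
  have hprob : IsProbabilityMeasure (μ.map X) := Measure.isProbabilityMeasure_map hX.aemeasurable
  have hsq : ∀ i, ∫⁻ x, ‖x i‖ₑ ^ 2 ∂(μ.map X) ≤ 1 := by
    intro i
    rw [lintegral_map (by fun_prop) hX]
    exact hiso.lintegral_enorm_sq_le i
  have hm0 : (0 : ℝ) < m := by exact_mod_cast hm
  have hmn' : (m : ℝ) ≤ n := by exact_mod_cast hmn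
  have hL : 0 < log (exp 1 * n / m) := by
    refine Real.log_pos ((one_lt_div hm0).mpr ?_)
    have := Real.add_one_lt_exp (one_ne_zero (α := ℝ))
    nlinarith
  refine le_exp_neg_sSup ENNReal.toReal_nonneg
    (ENNReal.toReal_le_of_le_ofReal zero_le_one (by simpa using prob_le_one)) ?_
  rintro p ⟨hp, hps⟩
  have hl2 : 2 ≤ max 2 ⌈p⌉₊ := le_max_left _ _
  have hpl : p ≤ (max 2 ⌈p⌉₊ : ℕ) := (Nat.le_ceil p).trans (by exact_mod_cast le_max_right _ _)
  have hlp : ((max 2 ⌈p⌉₊ : ℕ) : ℝ) ≤ 2 * p := by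
    rw [Nat.cast_max]
    refine max_le (by push_cast; linarith) ?_
    linarith [Nat.ceil_lt_add_one (zero_le_one.trans hp)]
  refine ENNReal.toReal_le_of_le_ofReal (exp_pos _).le (le_trans ?_
    (ENNReal.ofReal_le_ofReal (Real.exp_le_exp.mpr (neg_le_neg hpl))))
  refine le_trans ?_ (htail hν hl2 hm hmn ht hsq (hweak hν hp hpl hlp (by positivity) ?_))
  · refine le_trans (measure_mono fun ω hω => ?_) (Measure.le_map_apply hX.aemeasurable _)
    exact exists_finset_of_le_iSup_sqrt hmn (X ω) hω
  · intro u hu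
    rw [lintegral_map (by fun_prop) hX]
    refine lintegral_inner_rpow_le_of_sigmaX_le hX hp ?_ hps hu
    have := hν.lintegral_norm_rpow_lt_top hsq hp
    rwa [lintegral_map (by fun_prop) hX] at this

end
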